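/- arXiv:1910.06740 — 3 statements merged into one kernel-verified Lean document; each statement's English description precedes it below -/
import Mathlib

section
/- Assume that for every positive integer n with n > t there exists a perfect t-deletion binary code C_n of length n. Then the cardinality of C_n is asymptotically t!·2^n/n^t; more precisely, lim_{n→∞} (#C_n)·n^t/(t!·2^n) = 1, and likewise lim_{n→∞} M^t(n)·n^t/(t!·2^n) = 1, where M^t(n) denotes the maximum cardinality of a t-deletion code of length n. -/
open Filter Finset

/-- The number of runs of a binary sequence (maximal blocks of equal consecutive symbols). -/
def runsCount (x : List Bool) : ℕ := (x.destutter (· ≠ ·)).length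

/-- The deletion sphere `dS^t(x)`: all sequences obtained from `x` by deleting `t` symbols,
i.e. the sublists of `x` of length `x.length - t`. -/
def delSphere (t : ℕ) (x : List Bool) : Set (List Bool) :=
  {y | y.Sublist x ∧ y.length = x.length - t}

/-- `dS^t(X)` for a set `X` of sequences. -/
def delSphereSet (t : ℕ) (X : Set (List Bool)) : Set (List Bool) :=
  ⋃ x ∈ X, delSphere t x

/-- A `t`-deletion code of length `n`: a set of binary sequences of length `n`
with pairwise disjoint deletion spheres. -/
def IsDeletionCode (t n : ℕ) (C : Set (List Bool)) : Prop :=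
  (∀ c ∈ C, c.length = n) ∧
  ∀ c ∈ C, ∀ d ∈ C, c ≠ d → delSphere t c ∩ delSphere t d = ∅

/-- A perfect `t`-deletion code of length `n`: the deletion spheres of codewords
cover all of `𝔹^{n-t}`. -/
def IsPerfectDeletionCode (t n : ℕ) (C : Set (List Bool)) : Prop :=
  IsDeletionCode t n C ∧ delSphereSet t C = {y : List Bool | y.length = n - t}

/-- `M^t(n)`: the maximum cardinality of a `t`-deletion code of length `n`. -/
noncomputable def maxDelCodeSize (t n : ℕ) : ℕ :=
  sSup {m : ℕ | ∃ C : Set (List Bool), IsDeletionCode t n C ∧ C.ncard = m}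

/-- Number of runs, recursively. -/
def nRuns : List Bool → ℕ
  | [] => 0
  | [_] => 1
  | a :: b :: l => nRuns (b :: l) + if a = b then 0 else 1

/-- All words of length `n`. -/
def allWords : ℕ → Finset (List Bool)
  | 0 => {[]}
  | n + 1 => (allWords n).image (List.cons false) ∪ (allWords n).image (List.cons true)

theorem mem_allWords (n : ℕ) (x : List Bool) : x ∈ allWords n ↔ x.length = n := by
  induction n generalizing x with
  | zero => simp [allWords]
  | succ n ih =>
    cases x with
    | nil => simp [allWords]
    | cons a x => cases a <;> simp [allWords, ih]

theorem sum_allWords_succ (n : ℕ) (f : List Bool → ℝ) :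
    ∑ x ∈ allWords (n + 1), f x = ∑ x ∈ allWords n, (f (false :: x) + f (true :: x)) := by
  rw [allWords, Finset.sum_union, Finset.sum_image, Finset.sum_image, Finset.sum_add_distrib]
  · intro a _ b _ h; simpa using h
  · intro a _ b _ h; simpa using h
  · rw [Finset.disjoint_left]
    intro x hx hy
    simp only [Finset.mem_image] at hx hy
    obtain ⟨u, _, rfl⟩ := hx
    obtain ⟨v, _, hv⟩ := hy
    simp at hv

theorem card_allWords (n : ℕ) : (allWords n).card = 2 ^ n := by
  have h : ((allWords n).card : ℝ) = 2 ^ n := by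
    induction n with
    | zero => simp [allWords]
    | succ n ih =>
      have := sum_allWords_succ n (fun _ => 1)
      simp only [Finset.sum_const, nsmul_eq_mul, mul_one] at this
      rw [this, ih]; ring
  exact_mod_cast h

theorem sum_pow_runs (s : ℝ) (n : ℕ) :
    ∑ x ∈ allWords (n + 1), s ^ nRuns x = 2 * s * (1 + s) ^ n := by
  induction n with
  | zero => simp [allWords, nRuns]; ring
  | succ n ih =>
    rw [sum_allWords_succ, pow_succ, ← mul_assoc, ← ih, Finset.sum_mul]
    refine Finset.sum_congr rfl fun x hx => ?_
    rw [mem_allWords] at hx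
    cases x with
    | nil => simp at hx
    | cons b l => cases b <;> simp [nRuns, pow_succ] <;> ring

theorem nRuns_le_length (x : List Bool) : nRuns x ≤ x.length := by
  induction x with
  | nil => simp [nRuns]
  | cons a x ih =>
    cases x with
    | nil => simp [nRuns]
    | cons b l => simp only [nRuns, List.length_cons] at *; split_ifs <;> omega

theorem nRuns_cons_ge (a : Bool) (x : List Bool) : nRuns x ≤ nRuns (a :: x) := by
  cases x with
  | nil => simp [nRuns]
  | cons b l => simp [nRuns]

theorem nRuns_cons_le (a : Bool) (x : List Bool) : nRuns (a :: x) ≤ nRuns x + 1 := by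
  cases x with
  | nil => simp [nRuns]
  | cons b l => simp only [nRuns]; split_ifs <;> omega

/-- Deletion sphere as a finset, without truncated subtraction. -/
def sph (t : ℕ) (x : List Bool) : Finset (List Bool) :=
  x.sublists.toFinset.filter (fun y => y.length + t = x.length)

theorem mem_sph (t : ℕ) (x y : List Bool) :
    y ∈ sph t x ↔ y.Sublist x ∧ y.length + t = x.length := by
  simp [sph]

theorem card_sph_zero (x : List Bool) : (sph 0 x).card = 1 := by
  have : sph 0 x = {x} := by
    ext y
    rw [mem_sph, Finset.mem_singleton]
    constructor
    · rintro ⟨h, h'⟩; exact h.eq_of_length (by simpa using h')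
    · rintro rfl; simp
  rw [this]; simp

theorem first_run (t : ℕ) (a : Bool) (x : List Bool) :
    ∃ (k : ℕ) (w : List Bool), w.length ≤ x.length ∧ nRuns w + 1 = nRuns (a :: x) ∧
      ∀ y ∈ sph (t + 1) (a :: x), y ∈ sph t x ∨
        ∃ z ∈ sph (t + 1) w, y = List.replicate k a ++ z := by
  induction x generalizing a with
  | nil =>
    refine ⟨1, [], by simp, by simp [nRuns], ?_⟩
    intro y hy
    rw [mem_sph] at hy
    left
    rw [mem_sph]
    simp at hy ⊢
    rcases hy with ⟨h, h'⟩
    have : y.length = 0 := by omega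
    have : y = [] := List.length_eq_zero_iff.mp this
    exact ⟨this, by omega⟩
  | cons b x ih =>
    by_cases hab : a = b
    · subst hab
      obtain ⟨k, w, hw, hr, H⟩ := ih a
      refine ⟨k + 1, w, by simp; omega, by simp [nRuns, hr], ?_⟩
      intro y hy
      rw [mem_sph] at hy
      obtain ⟨hs, hl⟩ := hy
      rw [List.sublist_cons_iff] at hs
      rcases hs with hs | ⟨r, rfl, hs⟩
      · left; rw [mem_sph]; exact ⟨hs, by simp at hl ⊢; omega⟩
      · rcases H r ((mem_sph _ _ _).2 ⟨hs, by simp at hl ⊢; omega⟩) with h | ⟨z, hz, rfl⟩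
        · left
          rw [mem_sph] at h ⊢
          exact ⟨h.1.cons_cons a, by simp; omega⟩
        · right; exact ⟨z, hz, by simp [List.replicate_succ]⟩
    · refine ⟨1, b :: x, by simp, by simp [nRuns, hab], ?_⟩
      intro y hy
      rw [mem_sph] at hy
      obtain ⟨hs, hl⟩ := hy
      rw [List.sublist_cons_iff] at hs
      rcases hs with hs | ⟨r, rfl, hs⟩
      · left; rw [mem_sph]; exact ⟨hs, by simp at hl ⊢; omega⟩
      · right; exact ⟨r, (mem_sph _ _ _).2 ⟨hs, by simp at hl ⊢; omega⟩, by simp⟩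

theorem card_sph_le_aux (n : ℕ) : ∀ (t : ℕ) (x : List Bool) (r : ℕ), x.length ≤ n →
    nRuns x ≤ r → (sph (t + 1) x).card ≤ (r + t).choose (t + 1) := by
  induction n with
  | zero =>
    intro t x r hx _
    have : x = [] := List.length_eq_zero_iff.mp (by omega)
    subst this
    have : sph (t + 1) [] = ∅ := by
      ext y; rw [mem_sph]; simp
    simp [this]
  | succ n ih =>
    intro t x r hx hr
    cases x with
    | nil => exact ih t [] r (by simp) hr
    | cons a x =>
      obtain ⟨k, w, hw, hrw, H⟩ := first_run t a x
      have hsub : sph (t + 1) (a :: x) ⊆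
          sph t x ∪ (sph (t + 1) w).image (fun z => List.replicate k a ++ z) := by
        intro y hy
        rw [Finset.mem_union, Finset.mem_image]
        rcases H y hy with h | ⟨z, hz, rfl⟩
        · exact Or.inl h
        · exact Or.inr ⟨z, hz, rfl⟩
      have h1 := (Finset.card_le_card hsub).trans (Finset.card_union_le _ _)
      have h2 := Finset.card_image_le (s := sph (t + 1) w) (f := fun z => List.replicate k a ++ z)
      simp only [List.length_cons] at hx
      obtain ⟨r', rfl⟩ : ∃ r', r = r' + 1 := ⟨r - 1, by omega⟩
      have h3 := ih t w r' (by omega) (by omega)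
      have h4 : (sph t x).card ≤ (r' + t).choose t := by
        cases t with
        | zero => simp [card_sph_zero]
        | succ t =>
          have := ih t x (r' + 1) (by omega) ((nRuns_cons_ge a x).trans hr)
          rwa [show r' + (t + 1) = r' + 1 + t by ring]
      rw [show r' + 1 + t = (r' + t) + 1 by ring, Nat.choose_succ_succ']
      omega

theorem card_sph_ge_aux (n : ℕ) : ∀ (t : ℕ) (x : List Bool) (m : ℕ), x.length ≤ n →
    m + t ≤ nRuns x + 1 → m.choose t ≤ (sph t x).card := by
  induction n with
  | zero =>
    intro t x m hx hm
    have : x = [] := List.length_eq_zero_iff.mp (by omega)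
    subst this
    cases t with
    | zero => simp [card_sph_zero]
    | succ t =>
      have : m = 0 := by simp [nRuns] at hm; omega
      subst this; simp
  | succ n ih =>
    intro t x m hx hm
    cases t with
    | zero => simp [card_sph_zero]
    | succ t =>
    cases m with
    | zero => simp
    | succ m =>
    match x, hx, hm with
    | [], _, hm => simp [nRuns] at hm; omega
    | [a], _, hm =>
      simp [nRuns] at hm
      obtain ⟨rfl, rfl⟩ : m = 0 ∧ t = 0 := by omega
      have : [] ∈ sph (0 + 1) [a] := by rw [mem_sph]; simp
      simpa using Finset.card_pos.2 ⟨_, this⟩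
    | a :: b :: v, hx, hm =>
      simp only [List.length_cons] at hx
      have hcons : (sph (t + 1) (b :: v)).image (List.cons a) ⊆ sph (t + 1) (a :: b :: v) := by
        intro y hy
        rw [Finset.mem_image] at hy
        obtain ⟨z, hz, rfl⟩ := hy
        rw [mem_sph] at hz ⊢
        exact ⟨hz.1.cons_cons a, by simp at hz ⊢; omega⟩
      have hcard : ((sph (t + 1) (b :: v)).image (List.cons a)).card = (sph (t + 1) (b :: v)).card :=
        Finset.card_image_of_injective _ (List.cons_injective)
      by_cases hab : a = b
      · have := ih (t + 1) (b :: v) (m + 1) (by simp; omega) (by simpa [nRuns, hab] using hm)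
        exact (this.trans hcard.ge).trans (Finset.card_le_card hcons)
      · have hcons2 : (sph t v).image (List.cons b) ⊆ sph (t + 1) (a :: b :: v) := by
          intro y hy
          rw [Finset.mem_image] at hy
          obtain ⟨z, hz, rfl⟩ := hy
          rw [mem_sph] at hz ⊢
          exact ⟨(hz.1.cons_cons b).cons a, by simp at hz ⊢; omega⟩
        have hcard2 : ((sph t v).image (List.cons b)).card = (sph t v).card :=
          Finset.card_image_of_injective _ (List.cons_injective)
        have hd : Disjoint ((sph (t + 1) (b :: v)).image (List.cons a))
            ((sph t v).image (List.cons b)) := by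
          rw [Finset.disjoint_left]
          intro y hy hy'
          simp only [Finset.mem_image] at hy hy'
          obtain ⟨z, _, rfl⟩ := hy
          obtain ⟨z', _, h⟩ := hy'
          simp at h
          exact hab h.1.symm
        have h0 := Finset.card_le_card (Finset.union_subset hcons hcons2)
        rw [Finset.card_union_of_disjoint hd, hcard, hcard2] at h0
        have hr := nRuns_cons_le b v
        simp only [nRuns, hab, if_false] at hm
        have h1 := ih (t + 1) (b :: v) m (by simp; omega) (by omega)
        have h2 := ih t v m (by omega) (by omega)
        rw [Nat.choose_succ_succ']
        omega

theorem card_sph_le (t : ℕ) (x : List Bool) :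
    (t.factorial : ℝ) * (sph t x).card ≤ ((nRuns x : ℝ) + t) ^ t := by
  cases t with
  | zero => simp [card_sph_zero]
  | succ t =>
    have h := card_sph_le_aux x.length t x _ le_rfl le_rfl
    have h2 := Nat.descFactorial_le_pow (nRuns x + t) (t + 1)
    rw [Nat.descFactorial_eq_factorial_mul_choose] at h2
    have h3 : (t + 1).factorial * (sph (t + 1) x).card ≤ (nRuns x + (t + 1)) ^ (t + 1) :=
      (Nat.mul_le_mul_left _ h).trans (h2.trans (Nat.pow_le_pow_left (by omega) _))
    exact_mod_cast h3

theorem card_sph_ge (t : ℕ) (x : List Bool) (h : 2 * t ≤ nRuns x) :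
    ((nRuns x : ℝ) - 2 * t) ^ t ≤ (t.factorial : ℝ) * (sph t x).card := by
  have h1 := card_sph_ge_aux x.length t x (nRuns x + 1 - t) le_rfl (by omega)
  have h2 := Nat.pow_sub_le_descFactorial (nRuns x + 1 - t) t
  rw [Nat.descFactorial_eq_factorial_mul_choose] at h2
  have h3 : (nRuns x - 2 * t) ^ t ≤ t.factorial * (sph t x).card :=
    (Nat.pow_le_pow_left (by omega) _).trans (h2.trans (Nat.mul_le_mul_left _ h1))
  have h4 : (((nRuns x - 2 * t) ^ t : ℕ) : ℝ) ≤ ((t.factorial * (sph t x).card : ℕ) : ℝ) := by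
    exact_mod_cast h3
  push_cast [Nat.cast_sub h] at h4
  exact h4

theorem sum_exp_runs (b : ℝ) (n : ℕ) (hn : 0 < n) :
    ∑ x ∈ allWords n, Real.exp (b * (2 * nRuns x - n)) ≤ 2 * (2 * Real.cosh b) ^ n := by
  obtain ⟨n, rfl⟩ : ∃ k, n = k + 1 := ⟨n - 1, by omega⟩
  have h1 : ∀ x : List Bool, Real.exp (b * (2 * nRuns x - ((n + 1 : ℕ) : ℝ))) =
      Real.exp (-b) ^ (n + 1) * Real.exp (2 * b) ^ nRuns x := by
    intro x
    rw [← Real.exp_nat_mul, ← Real.exp_nat_mul, ← Real.exp_add]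
    congr 1; push_cast; ring
  simp only [h1]
  rw [← Finset.mul_sum, sum_pow_runs]
  have h2 : 2 * Real.cosh b = Real.exp (-b) * (1 + Real.exp (2 * b)) := by
    rw [Real.cosh_eq, mul_add, ← Real.exp_add]; ring_nf
  rw [h2, mul_pow, pow_succ (1 + Real.exp (2 * b))]
  have hp : 0 < Real.exp (2 * b) := Real.exp_pos _
  have : 0 ≤ Real.exp (-b) ^ (n + 1) * (1 + Real.exp (2 * b)) ^ n := by positivity
  nlinarith

/-- words with atypical number of runs -/
noncomputable def badWords (δ : ℝ) (n : ℕ) : Finset (List Bool) :=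
  (allWords n).filter (fun x => δ * n ≤ |2 * (nRuns x : ℝ) - n|)

theorem card_badWords (δ : ℝ) (hδ : 0 < δ) (n : ℕ) (hn : 0 < n) :
    ((badWords δ n).card : ℝ) ≤ 4 * 2 ^ n * Real.exp (-(δ ^ 2 / 2)) ^ n := by
  have h1 : ((badWords δ n).card : ℝ) * Real.exp (δ * (δ * n)) ≤
      ∑ x ∈ allWords n, (Real.exp (δ * (2 * nRuns x - n)) + Real.exp (-δ * (2 * nRuns x - n))) := by
    calc ((badWords δ n).card : ℝ) * Real.exp (δ * (δ * n))
        = ∑ x ∈ badWords δ n, Real.exp (δ * (δ * n)) := by simp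
      _ ≤ ∑ x ∈ badWords δ n,
          (Real.exp (δ * (2 * nRuns x - n)) + Real.exp (-δ * (2 * nRuns x - n))) := by
          refine Finset.sum_le_sum fun x hx => ?_
          have hx := (Finset.mem_filter.1 hx).2
          have p1 := Real.exp_pos (δ * (2 * nRuns x - n))
          have p2 := Real.exp_pos (-δ * (2 * nRuns x - n))
          rcases le_abs.1 hx with h | h
          · have : Real.exp (δ * (δ * n)) ≤ Real.exp (δ * (2 * nRuns x - n)) :=
              Real.exp_le_exp.2 (mul_le_mul_of_nonneg_left h hδ.le)
            linarith
          · have : Real.exp (δ * (δ * n)) ≤ Real.exp (-δ * (2 * nRuns x - n)) :=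
              Real.exp_le_exp.2 (by
                have := mul_le_mul_of_nonneg_left h hδ.le
                linarith)
            linarith
      _ ≤ _ := Finset.sum_le_sum_of_subset_of_nonneg (Finset.filter_subset _ _)
          (fun x _ _ => by positivity)
  rw [Finset.sum_add_distrib] at h1
  have h2 := sum_exp_runs δ n hn
  have h3 := sum_exp_runs (-δ) n hn
  rw [Real.cosh_neg] at h3
  have h4 : (2 * Real.cosh δ) ^ n ≤ 2 ^ n * Real.exp (δ ^ 2 / 2) ^ n := by
    rw [mul_pow]
    gcongr
    exact Real.cosh_le_exp_half_sq δ
  have h5 : Real.exp (δ ^ 2 / 2) ^ n =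
      Real.exp (-(δ ^ 2 / 2)) ^ n * Real.exp (δ * (δ * n)) := by
    rw [← Real.exp_nat_mul, ← Real.exp_nat_mul, ← Real.exp_add]
    congr 1; ring
  rw [h5] at h4
  have h6 : ((badWords δ n).card : ℝ) * Real.exp (δ * (δ * n)) ≤
      (4 * 2 ^ n * Real.exp (-(δ ^ 2 / 2)) ^ n) * Real.exp (δ * (δ * n)) := by linarith
  exact le_of_mul_le_mul_right h6 (Real.exp_pos _)

theorem coe_sph {t n : ℕ} (htn : t ≤ n) {x : List Bool} (hx : x.length = n) :
    (sph t x : Set (List Bool)) = delSphere t x := by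
  ext y
  simp only [Finset.mem_coe, mem_sph, delSphere, Set.mem_ofPred_eq]
  refine and_congr_right fun _ => ?_
  omega

theorem code_finite {t n : ℕ} {C : Set (List Bool)} (hC : IsDeletionCode t n C) : C.Finite :=
  (allWords n).finite_toSet.subset fun c hc => by
    rw [Finset.mem_coe, mem_allWords]; exact hC.1 c hc

/-- Packing bound. -/
theorem packing {t n : ℕ} (htn : t ≤ n) {C : Set (List Bool)} (hC : IsDeletionCode t n C)
    (F : Finset (List Bool)) (hF : (F : Set (List Bool)) ⊆ C) :
    ∑ c ∈ F, ((sph t c).card : ℝ) ≤ 2 ^ (n - t) := by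
  have hd : ∀ c ∈ F, ∀ d ∈ F, c ≠ d → Disjoint (sph t c) (sph t d) := by
    intro c hc d hd hne
    rw [← Finset.disjoint_coe, coe_sph htn (hC.1 c (hF hc)), coe_sph htn (hC.1 d (hF hd)),
      Set.disjoint_iff_inter_eq_empty]
    exact hC.2 c (hF hc) d (hF hd) hne
  have h1 := Finset.card_biUnion hd
  have h2 : F.biUnion (sph t) ⊆ allWords (n - t) := by
    intro y hy
    rw [Finset.mem_biUnion] at hy
    obtain ⟨c, hc, hy⟩ := hy
    rw [mem_sph, hC.1 c (hF hc)] at hy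
    rw [mem_allWords]; omega
  have h3 := Finset.card_le_card h2
  rw [card_allWords, h1] at h3
  exact_mod_cast h3

theorem covering {t n : ℕ} (htn : t ≤ n) {C : Set (List Bool)} (hC : IsPerfectDeletionCode t n C)
    (F : Finset (List Bool)) (hF : (F : Set (List Bool)) = C) :
    (2 : ℝ) ^ (n - t) ≤ ∑ c ∈ F, ((sph t c).card : ℝ) := by
  have h2 : allWords (n - t) ⊆ F.biUnion (sph t) := by
    intro y hy
    rw [mem_allWords] at hy
    have : y ∈ delSphereSet t C := by rw [hC.2]; exact hy
    simp only [delSphereSet, Set.mem_iUnion] at this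
    obtain ⟨c, hc, hy⟩ := this
    rw [Finset.mem_biUnion]
    refine ⟨c, by rw [← Finset.mem_coe, hF]; exact hc, ?_⟩
    rw [← Finset.mem_coe, coe_sph htn (hC.1.1 c hc)]; exact hy
  have h3 := (Finset.card_le_card h2).trans Finset.card_biUnion_le
  rw [card_allWords] at h3
  exact_mod_cast h3

theorem upper_bound (t : ℕ) (δ : ℝ) (hδ : 0 < δ) (hδ' : δ < 1 / 4) (n : ℕ) (hn : 0 < n)
    (htn : t ≤ n) (hlarge : 4 * (t : ℝ) ≤ δ * n) (C : Set (List Bool))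
    (hC : IsDeletionCode t n C) :
    (C.ncard : ℝ) * (n : ℝ) ^ t / ((t.factorial : ℝ) * 2 ^ n) ≤
      ((1 - 2 * δ) ^ t)⁻¹ + 4 * ((n : ℝ) ^ t * Real.exp (-(δ ^ 2 / 2)) ^ n) := by
  have hfin := code_finite hC
  set F := hfin.toFinset with hFdef
  have hFC : (F : Set (List Bool)) = C := hfin.coe_toFinset
  rw [Set.ncard_eq_toFinset_card C hfin, ← hFdef]
  set B := F.filter (fun x => δ * n ≤ |2 * (nRuns x : ℝ) - n|) with hB
  set G := F.filter (fun x => ¬ δ * n ≤ |2 * (nRuns x : ℝ) - n|) with hG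
  have hsplit : (F.card : ℝ) = B.card + G.card := by
    have := Finset.card_filter_add_card_filter_not (s := F)
      (fun x => δ * n ≤ |2 * (nRuns x : ℝ) - n|)
    rw [← hB, ← hG] at this
    rw [← this, Nat.cast_add]
  have hBc : (B.card : ℝ) ≤ 4 * 2 ^ n * Real.exp (-(δ ^ 2 / 2)) ^ n := by
    refine le_trans ?_ (card_badWords δ hδ n hn)
    have : B ⊆ badWords δ n := by
      intro x hx
      rw [hB, Finset.mem_filter] at hx
      rw [badWords, Finset.mem_filter, mem_allWords]
      exact ⟨hC.1 x (by rw [← hFC]; exact hx.1), hx.2⟩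
    exact_mod_cast Finset.card_le_card this
  have hGC : (G : Set (List Bool)) ⊆ C := by
    rw [← hFC]; exact_mod_cast Finset.filter_subset _ _
  have hn' : (0 : ℝ) < n := by exact_mod_cast hn
  have hGb : (G.card : ℝ) * ((1 - 2 * δ) ^ t * (n : ℝ) ^ t) ≤ t.factorial * 2 ^ n := by
    have hp := packing htn hC G hGC
    have h2 : (2 : ℝ) ^ n = 2 ^ (n - t) * 2 ^ t := by rw [← pow_add]; congr 1; omega
    calc (G.card : ℝ) * ((1 - 2 * δ) ^ t * (n : ℝ) ^ t)
        = ∑ c ∈ G, ((1 - 2 * δ) ^ t * (n : ℝ) ^ t) := by simp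
      _ ≤ ∑ c ∈ G, (t.factorial * 2 ^ t : ℝ) * (sph t c).card := by
          refine Finset.sum_le_sum fun c hc => ?_
          have hc := (Finset.mem_filter.1 hc).2
          rw [not_le, abs_lt] at hc
          have hr : (1 - 2 * δ) * n ≤ 2 * ((nRuns c : ℝ) - 2 * t) := by nlinarith [hc.1]
          have h0 : 0 ≤ (1 - 2 * δ) * n := by
            apply mul_nonneg _ hn'.le; linarith
          have hr2 : 2 * t ≤ nRuns c := by
            have : (2 * t : ℝ) ≤ nRuns c := by linarith
            exact_mod_cast this
          have h3 := card_sph_ge t c hr2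
          rw [← mul_pow]
          calc ((1 - 2 * δ) * n) ^ t ≤ (2 * ((nRuns c : ℝ) - 2 * t)) ^ t :=
                pow_le_pow_left₀ h0 hr t
            _ = 2 ^ t * ((nRuns c : ℝ) - 2 * t) ^ t := mul_pow _ _ _
            _ ≤ 2 ^ t * (t.factorial * (sph t c).card) := by gcongr
            _ = _ := by ring
      _ = (t.factorial * 2 ^ t : ℝ) * ∑ c ∈ G, ((sph t c).card : ℝ) := by rw [Finset.mul_sum]
      _ ≤ (t.factorial * 2 ^ t : ℝ) * 2 ^ (n - t) := by gcongr
      _ = _ := by rw [h2]; ring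
  have hf : (1 : ℝ) ≤ t.factorial := by exact_mod_cast t.factorial_pos
  have hd : (0 : ℝ) < (1 - 2 * δ) ^ t := by apply pow_pos; linarith
  rw [div_le_iff₀ (by positivity), hsplit]
  have e1 : (G.card : ℝ) * (n : ℝ) ^ t ≤ ((1 - 2 * δ) ^ t)⁻¹ * (t.factorial * 2 ^ n) := by
    rw [← div_eq_inv_mul, le_div_iff₀ hd]; linarith
  have e2 : (B.card : ℝ) * (n : ℝ) ^ t ≤
      4 * ((n : ℝ) ^ t * Real.exp (-(δ ^ 2 / 2)) ^ n) * (t.factorial * 2 ^ n) := by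
    calc (B.card : ℝ) * (n : ℝ) ^ t ≤ (4 * 2 ^ n * Real.exp (-(δ ^ 2 / 2)) ^ n) * (n : ℝ) ^ t := by
          gcongr
      _ = 4 * ((n : ℝ) ^ t * Real.exp (-(δ ^ 2 / 2)) ^ n) * (1 * 2 ^ n) := by ring
      _ ≤ _ := by gcongr
  linarith

theorem lower_bound (t : ℕ) (δ : ℝ) (hδ : 0 < δ) (n : ℕ) (hn : 0 < n)
    (htn : t ≤ n) (hlarge : 4 * (t : ℝ) ≤ δ * n) (C : Set (List Bool))
    (hC : IsPerfectDeletionCode t n C) :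
    1 - 4 ^ (t + 1) * ((n : ℝ) ^ t * Real.exp (-(δ ^ 2 / 2)) ^ n) ≤
    (1 + 2 * δ) ^ t * ((C.ncard : ℝ) * (n : ℝ) ^ t / ((t.factorial : ℝ) * 2 ^ n)) := by
  have hfin := code_finite hC.1
  set F := hfin.toFinset with hFdef
  have hFC : (F : Set (List Bool)) = C := hfin.coe_toFinset
  rw [Set.ncard_eq_toFinset_card C hfin, ← hFdef]
  set B := F.filter (fun x => δ * n ≤ |2 * (nRuns x : ℝ) - n|) with hB
  set G := F.filter (fun x => ¬ δ * n ≤ |2 * (nRuns x : ℝ) - n|) with hG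
  have hBc : (B.card : ℝ) ≤ 4 * 2 ^ n * Real.exp (-(δ ^ 2 / 2)) ^ n := by
    refine le_trans ?_ (card_badWords δ hδ n hn)
    have : B ⊆ badWords δ n := by
      intro x hx
      rw [hB, Finset.mem_filter] at hx
      rw [badWords, Finset.mem_filter, mem_allWords]
      exact ⟨hC.1.1 x (by rw [← hFC]; exact hx.1), hx.2⟩
    exact_mod_cast Finset.card_le_card this
  have hn' : (0 : ℝ) < n := by exact_mod_cast hn
  have h2 : (2 : ℝ) ^ n = 2 ^ (n - t) * 2 ^ t := by rw [← pow_add]; congr 1; omega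
  have hcov := covering htn hC F hFC
  have hsplit := Finset.sum_filter_add_sum_filter_not F
      (fun x => δ * n ≤ |2 * (nRuns x : ℝ) - n|) (fun c => ((sph t c).card : ℝ))
  rw [← hB, ← hG] at hsplit
  have hGs : (t.factorial * 2 ^ t : ℝ) * ∑ c ∈ G, ((sph t c).card : ℝ) ≤
      F.card * ((1 + 2 * δ) ^ t * (n : ℝ) ^ t) := by
    calc (t.factorial * 2 ^ t : ℝ) * ∑ c ∈ G, ((sph t c).card : ℝ)
        = ∑ c ∈ G, (t.factorial * 2 ^ t : ℝ) * (sph t c).card := by rw [Finset.mul_sum]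
      _ ≤ ∑ c ∈ G, ((1 + 2 * δ) ^ t * (n : ℝ) ^ t) := by
          refine Finset.sum_le_sum fun c hc => ?_
          have hc := (Finset.mem_filter.1 hc).2
          rw [not_le, abs_lt] at hc
          have ht0 : (0 : ℝ) ≤ t := by positivity
          have hr : 2 * ((nRuns c : ℝ) + t) ≤ (1 + 2 * δ) * n := by nlinarith [hc.2]
          rw [← mul_pow]
          calc (t.factorial * 2 ^ t : ℝ) * (sph t c).card
              = 2 ^ t * (t.factorial * (sph t c).card) := by ring
            _ ≤ 2 ^ t * ((nRuns c : ℝ) + t) ^ t := by gcongr; exact card_sph_le t c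
            _ = (2 * ((nRuns c : ℝ) + t)) ^ t := (mul_pow _ _ _).symm
            _ ≤ _ := by gcongr
      _ = G.card * ((1 + 2 * δ) ^ t * (n : ℝ) ^ t) := by simp
      _ ≤ _ := by gcongr; exact Finset.filter_subset _ _
  have hBs : (t.factorial * 2 ^ t : ℝ) * ∑ c ∈ B, ((sph t c).card : ℝ) ≤
      B.card * (4 ^ t * (n : ℝ) ^ t) := by
    calc (t.factorial * 2 ^ t : ℝ) * ∑ c ∈ B, ((sph t c).card : ℝ)
        = ∑ c ∈ B, (t.factorial * 2 ^ t : ℝ) * (sph t c).card := by rw [Finset.mul_sum]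
      _ ≤ ∑ c ∈ B, (4 ^ t * (n : ℝ) ^ t) := by
          refine Finset.sum_le_sum fun c hc => ?_
          have hc := (Finset.mem_filter.1 hc).1
          have hl : c.length = n := hC.1.1 c (by rw [← hFC]; exact hc)
          have hrn : (nRuns c : ℝ) ≤ n := by
            have := nRuns_le_length c
            rw [hl] at this
            exact_mod_cast this
          have htn' : (t : ℝ) ≤ n := by exact_mod_cast htn
          rw [← mul_pow]
          calc (t.factorial * 2 ^ t : ℝ) * (sph t c).card
              = 2 ^ t * (t.factorial * (sph t c).card) := by ring
            _ ≤ 2 ^ t * ((nRuns c : ℝ) + t) ^ t := by gcongr; exact card_sph_le t c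
            _ = (2 * ((nRuns c : ℝ) + t)) ^ t := (mul_pow _ _ _).symm
            _ ≤ _ := pow_le_pow_left₀ (by positivity) (by linarith) t
      _ = _ := by simp
  have hf : (1 : ℝ) ≤ t.factorial := by exact_mod_cast t.factorial_pos
  rw [← mul_div_assoc, le_div_iff₀ (by positivity), sub_mul, one_mul]
  have e0 : (t.factorial : ℝ) * 2 ^ n ≤
      (t.factorial * 2 ^ t : ℝ) * ∑ c ∈ F, ((sph t c).card : ℝ) := by
    rw [h2]
    calc (t.factorial : ℝ) * (2 ^ (n - t) * 2 ^ t) = (t.factorial * 2 ^ t : ℝ) * 2 ^ (n - t) := by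
          ring
      _ ≤ _ := by gcongr
  rw [← hsplit, mul_add] at e0
  have e2 : (B.card : ℝ) * (4 ^ t * (n : ℝ) ^ t) ≤
      4 ^ (t + 1) * ((n : ℝ) ^ t * Real.exp (-(δ ^ 2 / 2)) ^ n) * (t.factorial * 2 ^ n) := by
    calc (B.card : ℝ) * (4 ^ t * (n : ℝ) ^ t)
        ≤ (4 * 2 ^ n * Real.exp (-(δ ^ 2 / 2)) ^ n) * (4 ^ t * (n : ℝ) ^ t) := by
          gcongr
      _ = 4 ^ (t + 1) * ((n : ℝ) ^ t * Real.exp (-(δ ^ 2 / 2)) ^ n) * (1 * 2 ^ n) := by ring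
      _ ≤ _ := by gcongr
  linarith

theorem err_tendsto (t : ℕ) (δ : ℝ) (hδ : 0 < δ) (K : ℝ) :
    Tendsto (fun n : ℕ => K * ((n : ℝ) ^ t * Real.exp (-(δ ^ 2 / 2)) ^ n)) atTop (nhds 0) := by
  have h := tendsto_pow_const_mul_const_pow_of_abs_lt_one t (r := Real.exp (-(δ ^ 2 / 2))) (by
    rw [abs_of_pos (Real.exp_pos _), Real.exp_lt_one_iff]
    have : 0 < δ ^ 2 := by positivity
    linarith)
  simpa using h.const_mul K

theorem large_eventually (t : ℕ) (δ : ℝ) (hδ : 0 < δ) :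
    ∀ᶠ n : ℕ in atTop, 4 * (t : ℝ) ≤ δ * n :=
  ((tendsto_natCast_atTop_atTop (R := ℝ)).const_mul_atTop hδ).eventually_ge_atTop _

theorem upper_eventually (t : ℕ) (c : ℝ) (hc : 1 < c) :
    ∀ᶠ n : ℕ in atTop, ∀ C : Set (List Bool), IsDeletionCode t n C →
      (C.ncard : ℝ) * (n : ℝ) ^ t / ((t.factorial : ℝ) * 2 ^ n) < c := by
  have hcont : Tendsto (fun δ : ℝ => ((1 - 2 * δ) ^ t)⁻¹) (nhdsWithin 0 (Set.Ioi 0)) (nhds 1) := by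
    have : ContinuousAt (fun δ : ℝ => ((1 - 2 * δ) ^ t)⁻¹) 0 := by
      apply ContinuousAt.inv₀
      · fun_prop
      · simp
    have h := this.tendsto
    simp only [mul_zero, sub_zero, one_pow, inv_one] at h
    exact h.mono_left nhdsWithin_le_nhds
  have hsmall : ∀ᶠ δ : ℝ in nhdsWithin 0 (Set.Ioi 0), δ < 1 / 4 :=
    nhdsWithin_le_nhds (Iio_mem_nhds (by norm_num))
  obtain ⟨δ, ⟨h1, h2⟩, h3⟩ :=
    ((hcont.eventually_lt_const hc).and hsmall |>.and self_mem_nhdsWithin).exists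
  have h3 : 0 < δ := h3
  have herr := (err_tendsto t δ h3 4).eventually_lt_const (sub_pos.2 h1)
  filter_upwards [herr, large_eventually t δ h3, eventually_ge_atTop (t + 1)] with n e1 e2 e3 C hC
  have := upper_bound t δ h3 h2 n (by omega) (by omega) e2 C hC
  linarith

theorem lower_eventually (t : ℕ) (c : ℝ) (hc : c < 1) :
    ∀ᶠ n : ℕ in atTop, ∀ C : Set (List Bool), IsPerfectDeletionCode t n C →
      c < (C.ncard : ℝ) * (n : ℝ) ^ t / ((t.factorial : ℝ) * 2 ^ n) := by
  have hcont : Tendsto (fun δ : ℝ => (1 + 2 * δ) ^ t * c) (nhdsWithin 0 (Set.Ioi 0)) (nhds c) := by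
    have : Continuous (fun δ : ℝ => (1 + 2 * δ) ^ t * c) := by fun_prop
    have h := this.tendsto 0
    simp only [mul_zero, add_zero, one_pow, one_mul] at h
    exact h.mono_left nhdsWithin_le_nhds
  obtain ⟨δ, h1, h3⟩ :=
    ((hcont.eventually_lt_const hc).and self_mem_nhdsWithin).exists
  have h3 : 0 < δ := h3
  have herr := (err_tendsto t δ h3 (4 ^ (t + 1))).eventually_lt_const (sub_pos.2 h1)
  filter_upwards [herr, large_eventually t δ h3, eventually_ge_atTop (t + 1)] with n e1 e2 e3 C hC
  have h := lower_bound t δ h3 n (by omega) (by omega) e2 C hC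
  have hp : 0 < (1 + 2 * δ) ^ t := by positivity
  exact lt_of_mul_lt_mul_left (by linarith) hp.le

theorem bddAbove_code (t n : ℕ) :
    BddAbove {m : ℕ | ∃ C : Set (List Bool), IsDeletionCode t n C ∧ C.ncard = m} := by
  refine ⟨2 ^ n, ?_⟩
  rintro m ⟨C, hC, rfl⟩
  rw [← card_allWords n, ← Set.ncard_coe_finset]
  exact Set.ncard_le_ncard (fun c hc => by
    rw [Finset.mem_coe, mem_allWords]; exact hC.1 c hc) (allWords n).finite_toSet

theorem exists_max_code (t n : ℕ) :
    ∃ C : Set (List Bool), IsDeletionCode t n C ∧ C.ncard = maxDelCodeSize t n :=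
  Nat.sSup_mem (s := {m : ℕ | ∃ C : Set (List Bool), IsDeletionCode t n C ∧ C.ncard = m})
    ⟨0, ∅, by simp [IsDeletionCode], by simp⟩ (bddAbove_code t n)

/-- If for every `n > t` there exists a perfect `t`-deletion binary code `C n` of length `n`,
then `#C_n ~ M^t(n) ~ t!·2^n/n^t`. -/
theorem perfect_deletion_codes_achieve_asymptotic_optimality
    (t : ℕ) (ht : 0 < t) (C : ℕ → Set (List Bool))
    (hC : ∀ n : ℕ, t < n → IsPerfectDeletionCode t n (C n)) :
    Tendsto (fun n : ℕ =>
        ((C n).ncard : ℝ) * (n : ℝ) ^ t / ((t.factorial : ℝ) * 2 ^ n)) atTop (nhds 1) ∧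
    Tendsto (fun n : ℕ =>
        (maxDelCodeSize t n : ℝ) * (n : ℝ) ^ t / ((t.factorial : ℝ) * 2 ^ n)) atTop (nhds 1) := by

  have hlow : ∀ c : ℝ, c < 1 → ∀ᶠ n : ℕ in atTop,
      c < ((C n).ncard : ℝ) * (n : ℝ) ^ t / ((t.factorial : ℝ) * 2 ^ n) := by
    intro c hc
    filter_upwards [lower_eventually t c hc, eventually_gt_atTop t] with n h hn
    exact h _ (hC n hn)
  refine ⟨tendsto_order.2 ⟨hlow, ?_⟩, tendsto_order.2 ⟨?_, ?_⟩⟩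
  · intro c hc
    filter_upwards [upper_eventually t c hc, eventually_gt_atTop t] with n h hn
    exact h _ (hC n hn).1
  · intro c hc
    filter_upwards [hlow c hc, eventually_gt_atTop t] with n h hn
    refine lt_of_lt_of_le h ?_
    have : (C n).ncard ≤ maxDelCodeSize t n := le_csSup (bddAbove_code t n) ⟨C n, (hC n hn).1, rfl⟩
    gcongr
  · intro c hc
    filter_upwards [upper_eventually t c hc] with n h
    obtain ⟨D, hD, hDc⟩ := exists_max_code t n
    rw [← hDc]
    exact h D hD
end

section
/- Let C be a perfect t-deletion binary code of length n with n > t. Then #C ≥ (2^n/C(n−1,t)) · ((⌊n^{1/3}⌋+1)/(⌊n^{1/3}⌋+1+2t)) · (C(⌊n^{2/3}⌋+t−1, t)/C(⌊n^{2/3}⌋+⌊n^{1/3}⌋+3t−1, t)) · (1 − Σ_{0 ≤ r < ⌊n^{1/3}⌋−1+⌊n^{2/3}⌋+t} C(n−1,r)/2^{n−1} − Σ_{n−1−⌊n^{2/3}⌋+t < r ≤ n−1} C(n−1,r)/2^{n−1}). -/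
open Filter Finset

namespace PDC

/-- Number of runs, recursively. -/
def rc : List Bool → ℕ
  | [] => 0
  | [_] => 1
  | a :: b :: l => rc (b :: l) + if a = b then 0 else 1

/-- All words of length `m`. -/
def words : ℕ → Finset (List Bool)
  | 0 => {[]}
  | m + 1 => (words m).image (List.cons true) ∪ (words m).image (List.cons false)

lemma mem_words (m : ℕ) (y : List Bool) : y ∈ words m ↔ y.length = m := by
  induction m generalizing y with
  | zero => simp [words]
  | succ m ih =>
    cases y with
    | nil => simp [words]
    | cons a y => cases a <;> simp [words, ih]

lemma sum_words_succ (m : ℕ) (g : List Bool → ℝ) :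
    ∑ y ∈ words (m + 1), g y
      = ∑ y ∈ words m, g (true :: y) + ∑ y ∈ words m, g (false :: y) := by
  rw [words, Finset.sum_union, Finset.sum_image, Finset.sum_image]
  · intro x _ y _ h; simpa using h
  · intro x _ y _ h; simpa using h
  · rw [Finset.disjoint_left]
    intro x hx hy
    simp only [Finset.mem_image] at hx hy
    obtain ⟨u, _, rfl⟩ := hx
    obtain ⟨v, _, hv⟩ := hy
    simp at hv

lemma pascal_sum (m : ℕ) (h : ℕ → ℝ) :
    ∑ k ∈ range (m + 2), ((m + 1).choose k : ℝ) * h k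
      = ∑ k ∈ range (m + 1), (m.choose k : ℝ) * h k
        + ∑ k ∈ range (m + 1), (m.choose k : ℝ) * h (k + 1) := by
  simpa using Finset.sum_choose_succ_mul (fun i _ => h i) m

lemma sum_rc_cons (m : ℕ) (a : Bool) (g : ℕ → ℝ) :
    ∑ y ∈ words m, g (rc (a :: y)) = ∑ k ∈ range (m + 1), (m.choose k : ℝ) * g (k + 1) := by
  induction m generalizing a g with
  | zero => simp [words, rc]
  | succ m ih =>
    rw [sum_words_succ, pascal_sum m (fun k => g (k + 1))]
    have h1 := ih true
    have h2 := ih false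
    cases a
    · simp only [rc]
      have e1 := h2 g
      have e2 := h1 (fun k => g (k + 1))
      simp only [if_true, Bool.false_eq_true, if_false, add_zero] 
      rw [← e1, ← e2, add_comm]
    · simp only [rc]
      have e1 := h1 g
      have e2 := h2 (fun k => g (k + 1))
      simp only [if_true, Bool.true_eq_false, if_false, add_zero] 
      rw [← e1, ← e2]

lemma sum_rc (m : ℕ) (g : ℕ → ℝ) :
    ∑ y ∈ words (m + 1), g (rc y)
      = 2 * ∑ k ∈ range (m + 1), (m.choose k : ℝ) * g (k + 1) := by
  rw [sum_words_succ m (fun y => g (rc y)), sum_rc_cons, sum_rc_cons, two_mul]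

lemma rc_cons_le (a : Bool) (l : List Bool) : rc (a :: l) ≤ rc l + 1 := by
  cases l with
  | nil => simp [rc]
  | cons b l => simp only [rc]; split_ifs <;> omega

lemma rc_le_cons (a : Bool) (l : List Bool) : rc l ≤ rc (a :: l) := by
  cases l with
  | nil => simp [rc]
  | cons b l => simp only [rc]; omega

lemma rc_sublist {y x : List Bool} (h : y.Sublist x) :
    ∀ a, rc (a :: x) + 2 * y.length ≤ rc (a :: y) + 2 * x.length := by
  induction h with
  | slnil => intro a; simp
  | @cons l₁ l₂ b h ih =>
    intro a
    have h1 := rc_cons_le a (b :: l₂)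
    have h2 := rc_cons_le b l₂
    have h3 := rc_le_cons a l₂
    have h4 := ih a
    simp only [List.length_cons]
    omega
  | @cons_cons l₁ l₂ b h ih =>
    intro a
    have h4 := ih b
    simp only [List.length_cons, rc]
    omega

lemma rc_sublist' {y x : List Bool} {t : ℕ} (h : y.Sublist x) (hl : x.length = y.length + t) :
    rc x ≤ rc y + 1 + 2 * t := by
  have h1 := rc_sublist h true
  have h2 := rc_cons_le true y
  have h3 := rc_le_cons true x
  omega

/-- Word with prescribed blocks. -/
def blocks : List (Bool × ℕ) → List Bool
  | [] => []
  | p :: R => List.replicate p.2 p.1 ++ blocks R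

lemma exists_blocks (x : List Bool) : ∃ R, blocks R = x ∧ R.length = rc x ∧
    (∀ a l, x = a :: l → ∃ k R', R = (a, k) :: R') := by
  induction x with
  | nil => exact ⟨[], rfl, rfl, by simp⟩
  | cons a l ih =>
    obtain ⟨R, h1, h2, h3⟩ := ih
    cases l with
    | nil => exact ⟨[(a, 1)], by simp [blocks], by simp [rc], by rintro _ _ ⟨⟩; exact ⟨_, _, rfl⟩⟩
    | cons b l =>
      by_cases hab : a = b
      · subst hab
        obtain ⟨k, R', rfl⟩ := h3 a l rfl
        refine ⟨(a, k + 1) :: R', ?_, ?_, ?_⟩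
        · simp only [blocks] at h1 ⊢
          rw [← h1]; simp [List.replicate_succ]
        · simpa [rc] using h2
        · rintro _ _ ⟨⟩; exact ⟨_, _, rfl⟩
      · refine ⟨(a, 1) :: R, ?_, ?_, ?_⟩
        · simp [blocks, h1]
        · simp [rc, hab, h2]
        · rintro _ _ ⟨⟩; exact ⟨_, _, rfl⟩

/-- Sphere as finset. -/
def sph (s : ℕ) (x : List Bool) : Finset (List Bool) :=
  x.sublists.toFinset.filter (fun y => y.length + s = x.length)

lemma mem_sph (s : ℕ) (x y : List Bool) :
    y ∈ sph s x ↔ y.Sublist x ∧ y.length + s = x.length := by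
  simp [sph]

lemma multichoose_mono_left (a s : ℕ) : Nat.multichoose a s ≤ Nat.multichoose (a + 1) s := by
  cases s with
  | zero => simp
  | succ s => rw [Nat.multichoose_succ_succ]; omega

lemma card_sph_blocks (R : List (Bool × ℕ)) :
    ∀ s, (sph s (blocks R)).card ≤ Nat.multichoose R.length s := by
  induction R with
  | nil =>
    intro s
    cases s with
    | zero => 
      simp only [Nat.multichoose_zero_right]
      rw [Finset.card_le_one]
      intro a ha b hb
      simp [mem_sph, blocks] at ha hb
      rw [ha, hb]
    | succ s =>
      have : sph (s + 1) (blocks []) = ∅ := by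
        ext y; simp [mem_sph, blocks]
      simp [this]
  | cons p R ih =>
    intro s
    obtain ⟨a, k⟩ := p
    induction s generalizing k with
    | zero =>
      simp only [Nat.multichoose_zero_right]
      rw [Finset.card_le_one]
      intro a ha b hb
      simp only [mem_sph, add_zero] at ha hb
      rw [ha.1.eq_of_length ha.2, hb.1.eq_of_length hb.2]
    | succ s ihs =>
      cases k with
      | zero =>
        have := ih (s + 1)
        simp only [blocks, List.replicate_zero, List.nil_append, List.length_cons]
        exact this.trans (multichoose_mono_left _ _)
      | succ k =>
        have hsub : sph (s + 1) (blocks ((a, k + 1) :: R)) ⊆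
            (sph (s + 1) (blocks R)).image (fun y => List.replicate (k + 1) a ++ y) ∪
              sph s (blocks ((a, k) :: R)) := by
          intro y hy
          rw [mem_sph] at hy
          obtain ⟨hy, hl⟩ := hy
          simp only [blocks] at hy hl
          obtain ⟨y1, y2, rfl, h1, h2⟩ := List.sublist_append_iff.1 hy
          obtain ⟨j, hj, rfl⟩ := List.sublist_replicate_iff.1 h1
          simp only [List.length_append, List.length_replicate] at hl
          rw [Finset.mem_union]
          by_cases hjk : j = k + 1
          · left
            subst hjk
            exact Finset.mem_image.2 ⟨y2, (mem_sph _ _ _).2 ⟨h2, by omega⟩, rfl⟩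
          · right
            rw [mem_sph]
            refine ⟨?_, ?_⟩
            · exact List.Sublist.append (List.sublist_replicate_iff.2 ⟨j, by omega, rfl⟩) h2
            · simp only [blocks, List.length_append, List.length_replicate]; omega
        calc _ ≤ _ := Finset.card_le_card hsub
          _ ≤ _ := Finset.card_union_le _ _
          _ ≤ Nat.multichoose R.length (s + 1) + Nat.multichoose (R.length + 1) s :=
            add_le_add (Finset.card_image_le.trans (ih _)) (by simpa using ihs k)
          _ = _ := by rw [List.length_cons, Nat.multichoose_succ_succ]

lemma card_sph (s : ℕ) (x : List Bool) : (sph s x).card ≤ Nat.multichoose (rc x) s := by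
  obtain ⟨R, h1, h2, _⟩ := exists_blocks x
  rw [← h1, ← h2] at *
  have := card_sph_blocks R s
  rw [h1] at *
  exact this

lemma multichoose_mono {a b : ℕ} (s : ℕ) (h : a ≤ b) : Nat.multichoose a s ≤ Nat.multichoose b s :=
  monotone_nat_of_le_succ (f := fun a => Nat.multichoose a s)
    (fun a => multichoose_mono_left a s) h

lemma sum_sph_le (t : ℕ) (c : List Bool) :
    ∑ y ∈ sph t c, (1 : ℝ) / (Nat.multichoose (rc y + 1 + 2 * t) t : ℝ) ≤ 1 := by
  have hc := card_sph t c
  rcases Nat.eq_zero_or_pos (Nat.multichoose (rc c) t) with h0 | h0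
  · have : sph t c = ∅ := by rw [← Finset.card_eq_zero]; omega
    simp [this]
  · have hp : (0 : ℝ) < Nat.multichoose (rc c) t := by exact_mod_cast h0
    calc _ ≤ ∑ y ∈ sph t c, (1 : ℝ) / (Nat.multichoose (rc c) t : ℝ) := by
          apply Finset.sum_le_sum
          intro y hy
          rw [mem_sph] at hy
          apply one_div_le_one_div_of_le hp
          exact_mod_cast multichoose_mono t (rc_sublist' hy.1 hy.2.symm)
      _ = (sph t c).card / (Nat.multichoose (rc c) t : ℝ) := by
          rw [Finset.sum_const, nsmul_eq_mul, mul_one_div]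
      _ ≤ 1 := by
          rw [div_le_one hp]; exact_mod_cast hc

lemma card_ge (t n : ℕ) (htn : t < n) (C : Set (List Bool)) (hC : IsPerfectDeletionCode t n C) :
    ∑ y ∈ words (n - t), (1 : ℝ) / (Nat.multichoose (rc y + 1 + 2 * t) t : ℝ) ≤ C.ncard := by
  classical
  have hfin : C.Finite := by
    apply (words n).finite_toSet.subset
    intro c hc
    simpa [mem_words] using hC.1.1 c hc
  set F := hfin.toFinset with hF
  have hcard : C.ncard = F.card := Set.ncard_eq_toFinset_card C hfin
  have hsub : words (n - t) ⊆ F.biUnion (sph t) := by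
    intro y hy
    rw [mem_words] at hy
    have h : y ∈ delSphereSet t C := by rw [hC.2]; exact hy
    simp only [delSphereSet, Set.mem_iUnion, delSphere, Set.mem_ofPred_eq] at h
    obtain ⟨c, hc, h1, h2⟩ := h
    have := hC.1.1 c hc
    rw [Finset.mem_biUnion]
    exact ⟨c, by simpa [hF] using hc, (mem_sph _ _ _).2 ⟨h1, by omega⟩⟩
  calc _ ≤ ∑ y ∈ F.biUnion (sph t), (1 : ℝ) / (Nat.multichoose (rc y + 1 + 2 * t) t : ℝ) := by
        apply Finset.sum_le_sum_of_subset_of_nonneg hsub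
        intros; positivity
    _ = ∑ y ∈ F.biUnion (sph t), (1 : ℝ) / (Nat.multichoose (rc y + 1 + 2 * t) t : ℝ) := rfl
    _ ≤ ∑ c ∈ F, ∑ y ∈ sph t c, (1 : ℝ) / (Nat.multichoose (rc y + 1 + 2 * t) t : ℝ) := by
        have hd : (∀ c ∈ F, ∀ d ∈ F, c ≠ d → Disjoint (sph t c) (sph t d)) := by
          intro c hc d hd hcd
          rw [Finset.disjoint_left]
          intro y hy hy'
          have hc' : c ∈ C := by simpa [hF] using hc
          have hd' : d ∈ C := by simpa [hF] using hd
          have := hC.1.2 c hc' d hd' hcd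
          rw [mem_sph] at hy hy'
          have : y ∈ delSphere t c ∩ delSphere t d :=
            ⟨⟨hy.1, by omega⟩, ⟨hy'.1, by omega⟩⟩
          simp_all
        rw [Finset.sum_biUnion hd]
    _ ≤ ∑ c ∈ F, (1 : ℝ) := Finset.sum_le_sum (fun c _ => sum_sph_le t c)
    _ = _ := by simp [hcard]

lemma ratio_step (t p q : ℕ) (h : p ≤ q) :
    (t + p).choose t * (t + q + 1).choose t ≤ (t + p + 1).choose t * (t + q).choose t := by
  have h1 := Nat.choose_mul_succ_eq (t + p) t
  have h2 := Nat.choose_mul_succ_eq (t + q) t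
  have e1 : t + p + 1 - t = p + 1 := by omega
  have e2 : t + q + 1 - t = q + 1 := by omega
  rw [e1] at h1
  rw [e2] at h2
  have hpos : 0 < (p + 1) * (q + 1) := by positivity
  refine Nat.le_of_mul_le_mul_right ?_ hpos
  calc (t + p).choose t * (t + q + 1).choose t * ((p + 1) * (q + 1))
      = (t + p).choose t * (p + 1) * ((t + q + 1).choose t * (q + 1)) := by ring
    _ = (t + p).choose t * (t + q).choose t * ((p + 1) * (t + q + 1)) := by rw [← h2]; ring
    _ ≤ (t + p).choose t * (t + q).choose t * ((t + p + 1) * (q + 1)) := by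
        apply Nat.mul_le_mul_left; nlinarith
    _ = ((t + p).choose t * (t + p + 1)) * (t + q).choose t * (q + 1) := by ring
    _ = _ := by rw [h1]; ring

lemma ratio_mono (t p q i : ℕ) (h : p ≤ q) :
    ((t + p).choose t : ℝ) / (t + q).choose t ≤ ((t + (p + i)).choose t : ℝ) / (t + (q + i)).choose t := by
  induction i with
  | zero => simp
  | succ i ih =>
    refine ih.trans ?_
    have hp : ∀ r, (0 : ℝ) < (t + r).choose t := fun r => by
      exact_mod_cast Nat.choose_pos (by omega)
    rw [div_le_div_iff₀ (hp _) (hp _)]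
    have := ratio_step t (p + i) (q + i) (by omega)
    exact_mod_cast this

lemma sum_split (W : ℕ → ℝ) (hW : ∀ j, 0 ≤ W j) (t m p : ℕ) :
    ∑ j ∈ range (m + t + 1), W j - ∑ j ∈ range (p + t), W j
      ≤ ∑ k ∈ range (m + 1), if p ≤ k then W (k + t) else 0 := by
  have hnn : ∀ s : ℕ, 0 ≤ ∑ k ∈ range s, if p ≤ k then W (k + t) else 0 := fun s =>
    Finset.sum_nonneg (fun k _ => by split_ifs; exacts [hW _, le_rfl])
  rcases le_total (m + 1) p with h | h
  · have : ∑ j ∈ range (m + t + 1), W j ≤ ∑ j ∈ range (p + t), W j := by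
      apply Finset.sum_le_sum_of_subset_of_nonneg
      · intro j; simp; omega
      · intros; exact hW _
    linarith [hnn (m + 1)]
  · obtain ⟨q, hq⟩ := Nat.exists_eq_add_of_le h
    have e : m + t + 1 = p + t + q := by omega
    rw [e, hq, Finset.sum_range_add _ (p + t) q, Finset.sum_range_add _ p q]
    have : ∑ x ∈ range q, W (p + t + x)
        = ∑ x ∈ range q, if p ≤ p + x then W (p + x + t) else 0 := by
      apply Finset.sum_congr rfl
      intro x _
      rw [if_pos (by omega)]; congr 1; omega
    linarith [hnn p]

lemma numeric (t m p a : ℕ) (ha : 1 ≤ a) :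
    (2 : ℝ) ^ (m + t + 1) / ((m + t).choose t : ℝ) *
      (((p + t).choose t : ℝ) / ((p + a + 3 * t).choose t : ℝ)) *
      (1 - ∑ j ∈ range (p + t), ((m + t).choose j : ℝ) / 2 ^ (m + t)) ≤
    2 * ∑ k ∈ range (m + 1), (m.choose k : ℝ) *
      ((1 : ℝ) / (Nat.multichoose (k + 1 + 1 + 2 * t) t : ℝ)) := by
  have hN : (0 : ℝ) < (m + t).choose t := by exact_mod_cast Nat.choose_pos (by omega)
  set A : ℝ := ((p + t).choose t : ℝ) / ((p + a + 3 * t).choose t : ℝ) with hA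
  have hA0 : 0 ≤ A := by positivity
  have key : ∀ k ∈ range (m + 1),
      (A / ((m + t).choose t : ℝ)) * (if p ≤ k then ((m + t).choose (k + t) : ℝ) else 0) ≤
      (m.choose k : ℝ) * ((1 : ℝ) / (Nat.multichoose (k + 1 + 1 + 2 * t) t : ℝ)) := by
    intro k hk
    split_ifs with hpk
    · obtain ⟨i, rfl⟩ := Nat.exists_eq_add_of_le hpk
      have hk' : p + i ≤ m := by simp at hk; omega
      have hch : ((m + t).choose (p + i + t) : ℝ) * ((p + i + t).choose t : ℝ)
          = ((m + t).choose t : ℝ) * (m.choose (p + i) : ℝ) := by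
        have := Nat.choose_mul (n := m + t) (k := p + i + t) (s := t) (by omega)
        have e1 : m + t - t = m := by omega
        have e2 : p + i + t - t = p + i := by omega
        rw [e1, e2] at this
        exact_mod_cast this
      have hmc : Nat.multichoose (p + i + 1 + 1 + 2 * t) t = (t + (p + 2 * t + 1 + i)).choose t := by
        rw [Nat.multichoose_eq]; congr 1; omega
      have hr := ratio_mono t p (p + 2 * t + 1) i (by omega)
      have hpos : (0 : ℝ) < (t + (p + 2 * t + 1 + i)).choose t := by
        exact_mod_cast Nat.choose_pos (by omega)
      have hpos2 : (0 : ℝ) < (t + (p + 2 * t + 1)).choose t := by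
        exact_mod_cast Nat.choose_pos (by omega)
      have hAr : A ≤ ((t + p).choose t : ℝ) / (t + (p + 2 * t + 1)).choose t := by
        rw [hA, add_comm p t]
        apply div_le_div_of_nonneg_left (by positivity) hpos2
        exact_mod_cast Nat.choose_le_choose t (by omega)
      have hAr2 := hAr.trans hr
      rw [hmc]
      calc _ ≤ ((t + (p + i)).choose t : ℝ) / (t + (p + 2 * t + 1 + i)).choose t
            / ((m + t).choose t : ℝ) * ((m + t).choose (p + i + t) : ℝ) := by gcongr
        _ = (((m + t).choose (p + i + t) : ℝ) * ((p + i + t).choose t : ℝ))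
            / ((m + t).choose t : ℝ) / (t + (p + 2 * t + 1 + i)).choose t := by
            rw [add_comm t (p + i)]; ring
        _ = _ := by rw [hch]; field_simp
    · rw [mul_zero]; positivity
  have hs := Finset.sum_le_sum key
  rw [← Finset.mul_sum] at hs
  have hsp := sum_split (fun j => ((m + t).choose j : ℝ)) (fun j => by positivity) t m p
  have htot : ∑ j ∈ range (m + t + 1), ((m + t).choose j : ℝ) = 2 ^ (m + t) := by
    exact_mod_cast Nat.sum_range_choose (m + t)
  rw [htot] at hsp
  have h2 := mul_le_mul_of_nonneg_left hsp (show 0 ≤ A / ((m + t).choose t : ℝ) by positivity)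
  calc _ = 2 * (A / ((m + t).choose t : ℝ)
        * (2 ^ (m + t) - ∑ j ∈ range (p + t), ((m + t).choose j : ℝ))) := by
        rw [← Finset.sum_div, pow_succ]; field_simp
    _ ≤ _ := by linarith

end PDC

open PDC


/-- Non-asymptotic lower bound on the size of a perfect `t`-deletion code of length `n > t`. -/
theorem perfect_deletion_code_card_lower_bound
    (t n : ℕ) (ht : 0 < t) (htn : t < n) (C : Set (List Bool))
    (hC : IsPerfectDeletionCode t n C) :
    ((C.ncard : ℝ)) ≥
      ((2 : ℝ) ^ n / ((n - 1).choose t : ℝ)) *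
      (((⌊(n : ℝ) ^ ((1 : ℝ) / 3)⌋₊ : ℝ) + 1) / ((⌊(n : ℝ) ^ ((1 : ℝ) / 3)⌋₊ : ℝ) + 1 + 2 * t)) *
      (((⌊(n : ℝ) ^ ((2 : ℝ) / 3)⌋₊ + t - 1).choose t : ℝ) /
        ((⌊(n : ℝ) ^ ((2 : ℝ) / 3)⌋₊ + ⌊(n : ℝ) ^ ((1 : ℝ) / 3)⌋₊ + 3 * t - 1).choose t : ℝ)) *
      (1
        - ∑ r ∈ Finset.range (⌊(n : ℝ) ^ ((1 : ℝ) / 3)⌋₊ - 1 + ⌊(n : ℝ) ^ ((2 : ℝ) / 3)⌋₊ + t),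
            ((n - 1).choose r : ℝ) / 2 ^ (n - 1)
        - ∑ r ∈ Finset.Icc (n - 1 - ⌊(n : ℝ) ^ ((2 : ℝ) / 3)⌋₊ + t + 1) (n - 1),
            ((n - 1).choose r : ℝ) / 2 ^ (n - 1)) := by
  have hn1 : (1 : ℝ) ≤ n := by exact_mod_cast (by omega : 1 ≤ n)
  have ha : 1 ≤ ⌊(n : ℝ) ^ ((1 : ℝ) / 3)⌋₊ :=
    (Nat.one_le_floor_iff _).2 (Real.one_le_rpow hn1 (by norm_num))
  have hb : 1 ≤ ⌊(n : ℝ) ^ ((2 : ℝ) / 3)⌋₊ :=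
    (Nat.one_le_floor_iff _).2 (Real.one_le_rpow hn1 (by norm_num))
  generalize ⌊(n : ℝ) ^ ((1 : ℝ) / 3)⌋₊ = a at *
  generalize ⌊(n : ℝ) ^ ((2 : ℝ) / 3)⌋₊ = b at *
  obtain ⟨p, rfl⟩ : ∃ p, b = p + 1 := ⟨b - 1, by omega⟩
  obtain ⟨m, rfl⟩ : ∃ m, n = m + t + 1 := ⟨n - t - 1, by omega⟩
  have h1 := card_ge t (m + t + 1) htn C hC
  have e : m + t + 1 - t = m + 1 := by omega
  rw [e, sum_rc m (fun r => (1 : ℝ) / (Nat.multichoose (r + 1 + 2 * t) t : ℝ))] at h1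
  have h2 := (numeric t m p a ha).trans h1
  refine ge_iff_le.2 (le_trans ?_ h2)
  have e1 : m + t + 1 - 1 = m + t := by omega
  have e2 : p + 1 + t - 1 = p + t := by omega
  have e3 : p + 1 + a + 3 * t - 1 = p + a + 3 * t := by omega
  rw [e1, e2, e3]
  have htail : ∀ s : Finset ℕ, 0 ≤ ∑ r ∈ s, ((m + t).choose r : ℝ) / 2 ^ (m + t) := fun s =>
    Finset.sum_nonneg (fun _ _ => by positivity)
  have hmono : ∑ r ∈ range (p + t), ((m + t).choose r : ℝ) / 2 ^ (m + t)
      ≤ ∑ r ∈ range (a - 1 + (p + 1) + t), ((m + t).choose r : ℝ) / 2 ^ (m + t) := by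
    apply Finset.sum_le_sum_of_subset_of_nonneg
    · intro j; simp; omega
    · intros; positivity
  have hone : ∑ r ∈ range (p + t), ((m + t).choose r : ℝ) / 2 ^ (m + t) ≤ 1 := by
    have htot : ∑ j ∈ range (m + t + 1), ((m + t).choose j : ℝ) = 2 ^ (m + t) := by
      exact_mod_cast Nat.sum_range_choose (m + t)
    have : ∑ r ∈ range (p + t), ((m + t).choose r : ℝ) ≤ 2 ^ (m + t) := by
      rw [← htot]
      rcases le_total (p + t) (m + t + 1) with h | h
      · apply Finset.sum_le_sum_of_subset_of_nonneg
        · intro j; simp; omega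
        · intros; positivity
      · rw [← Finset.sum_subset (s₁ := range (m + t + 1)) (s₂ := range (p + t))]
        · intro j; simp; omega
        · intro j _ hj
          simp only [Finset.mem_range, not_lt] at hj
          rw [Nat.choose_eq_zero_of_lt (by omega)]; simp
    rw [← Finset.sum_div]
    exact div_le_one_of_le₀ this (by positivity)
  have hfrac : ((a : ℝ) + 1) / ((a : ℝ) + 1 + 2 * t) ≤ 1 := by
    apply div_le_one_of_le₀
    · have : (0 : ℝ) ≤ t := by positivity
      linarith
    · positivity
  have hbr : 1 - ∑ r ∈ range (a - 1 + (p + 1) + t), ((m + t).choose r : ℝ) / 2 ^ (m + t)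
      - ∑ r ∈ Finset.Icc (m + t - (p + 1) + t + 1) (m + t), ((m + t).choose r : ℝ) / 2 ^ (m + t)
      ≤ 1 - ∑ r ∈ range (p + t), ((m + t).choose r : ℝ) / 2 ^ (m + t) := by
    linarith [htail (Finset.Icc (m + t - (p + 1) + t + 1) (m + t))]
  refine le_trans (mul_le_mul_of_nonneg_left hbr (by positivity)) ?_
  · apply mul_le_mul_of_nonneg_right _ (by linarith)
    apply mul_le_mul_of_nonneg_right _ (by positivity)
    exact mul_le_of_le_one_right (by positivity) hfrac
end

section
/- Let t be a positive integer and let a_1 < a_2 < a_3 < … be an infinite strictly increasing sequence of positive integers such that for every i there exists a perfect t-deletion binary code C_{a_i} of length a_i. Then lim_{i→∞} (#C_{a_i})·(a_i)^t/(t!·2^{a_i}) = 1. -/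
open Filter Finset

/-- Number of runs, by structural recursion. -/
def runsR : List Bool → ℕ
  | [] => 0
  | [_] => 1
  | a :: b :: l => (if a = b then 0 else 1) + runsR (b :: l)

/-- Sublists of `x` obtained by exactly `t` deletions, as a finset. -/
def delF (t : ℕ) (x : List Bool) : Finset (List Bool) :=
  (x.sublists.toFinset).filter (fun y => y.length + t = x.length)

theorem mem_delF {t : ℕ} {x y : List Bool} :
    y ∈ delF t x ↔ y.Sublist x ∧ y.length + t = x.length := by
  simp [delF]

theorem delF_zero (x : List Bool) : delF 0 x = {x} := by
  ext y
  simp only [mem_delF, Finset.mem_singleton, add_zero]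
  constructor
  · rintro ⟨h1, h2⟩
    exact h1.eq_of_length h2
  · rintro rfl
    simp

theorem runsR_cons_le (b : Bool) (l : List Bool) : runsR (b :: l) ≤ runsR l + 1 := by
  cases l with
  | nil => simp [runsR]
  | cons c l => simp only [runsR]; split_ifs <;> omega

theorem runsR_le_length (l : List Bool) : runsR l ≤ l.length := by
  induction l with
  | nil => simp [runsR]
  | cons c l ih => have := runsR_cons_le c l; simp; omega

theorem card_delF_cons (t : ℕ) (a : Bool) (x : List Bool) :
    (delF t x).card ≤ (delF t (a :: x)).card := by
  apply Finset.card_le_card_of_injOn (fun y => a :: y)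
  · intro y hy
    simp only [Finset.mem_coe, mem_delF] at hy ⊢
    refine ⟨hy.1.cons_cons a, ?_⟩
    simp; omega
  · intro y _ z _ h
    simpa using h

theorem card_delF_cons_ne (t : ℕ) (a b : Bool) (hab : a ≠ b) (x : List Bool) :
    (delF (t+1) (b :: x)).card + (delF t x).card ≤ (delF (t+1) (a :: b :: x)).card := by
  have h1 : ((delF (t+1) (b :: x)).image (fun y => a :: y)).card = (delF (t+1) (b :: x)).card :=
    Finset.card_image_of_injective _ (fun y z h => by simpa using h)
  have h2 : ((delF t x).image (fun y => b :: y)).card = (delF t x).card :=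
    Finset.card_image_of_injective _ (fun y z h => by simpa using h)
  rw [← h1, ← h2, ← Finset.card_union_of_disjoint]
  · apply Finset.card_le_card
    intro z hz
    simp only [Finset.mem_union, Finset.mem_image, mem_delF] at hz ⊢
    rcases hz with ⟨y, ⟨h3, h4⟩, rfl⟩ | ⟨y, ⟨h3, h4⟩, rfl⟩
    · refine ⟨h3.cons_cons a, ?_⟩
      simp at h4 ⊢; omega
    · refine ⟨(h3.cons_cons b).cons a, ?_⟩
      simp; omega
  · rw [Finset.disjoint_left]
    intro z hz hz'
    simp only [Finset.mem_image] at hz hz'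
    obtain ⟨y, _, rfl⟩ := hz
    obtain ⟨y', _, h⟩ := hz'
    simp at h
    exact hab h.1.symm

theorem choose_le_card_delF : ∀ (x : List Bool) (m t : ℕ), m + t ≤ runsR x →
    m.choose t ≤ (delF t x).card
  | x, m, 0, _ => by simp [delF_zero]
  | _, 0, t+1, _ => by simp
  | [], m+1, t+1, h => by simp [runsR] at h
  | [a], m+1, t+1, h => by simp [runsR] at h; omega
  | a :: b :: l, m+1, t+1, h => by
    by_cases hab : a = b
    · refine le_trans (choose_le_card_delF (b :: l) (m+1) (t+1) ?_) (card_delF_cons _ _ _)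
      simpa [runsR, hab] using h
    · refine le_trans ?_ (card_delF_cons_ne t a b hab l)
      simp only [runsR, hab, if_false] at h
      have h0 := runsR_cons_le b l
      have h1 := choose_le_card_delF (b :: l) m (t+1) (by omega)
      have h2 := choose_le_card_delF l m t (by omega)
      rw [Nat.choose_succ_succ']
      omega

theorem card_delF_replicate (r : ℕ) (a : Bool) (z : List Bool)
    (hz : ∀ s, (delF s z).card ≤ r.multichoose s) :
    ∀ (t k : ℕ), (delF t (List.replicate k a ++ z)).card ≤ (r+1).multichoose t := by
  intro t
  induction t with
  | zero => intro k; simp [delF_zero]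
  | succ t ih =>
    intro k
    rw [Nat.multichoose_succ_succ]
    cases k with
    | zero => simpa using le_trans (hz (t+1)) (Nat.le_add_right _ _)
    | succ k =>
      have hsub : delF (t+1) (List.replicate (k+1) a ++ z) ⊆
          (delF (t+1) z).image (fun y => List.replicate (k+1) a ++ y) ∪
          delF t (List.replicate k a ++ z) := by
        intro y hy
        rw [mem_delF] at hy
        obtain ⟨hy1, hy2⟩ := hy
        obtain ⟨p, q, rfl, hp, hq⟩ := List.sublist_append_iff.1 hy1
        obtain ⟨n, hn, rfl⟩ := List.sublist_replicate_iff.1 hp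
        simp only [List.length_append, List.length_replicate] at hy2
        rw [Finset.mem_union]
        rcases Nat.lt_or_ge n (k+1) with h | h
        · right
          rw [mem_delF]
          refine ⟨List.Sublist.append (List.replicate_sublist_replicate a |>.2 (by omega)) hq, ?_⟩
          simp; omega
        · left
          have : n = k + 1 := by omega
          subst this
          rw [Finset.mem_image]
          refine ⟨q, ?_, rfl⟩
          rw [mem_delF]
          exact ⟨hq, by omega⟩
      refine le_trans (Finset.card_le_card hsub) (le_trans (Finset.card_union_le _ _) ?_)
      exact add_le_add (le_trans Finset.card_image_le (hz (t+1))) (ih k)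

theorem card_delF_le_aux : ∀ (x : List Bool) (a : Bool) (k t : ℕ),
    (delF t (List.replicate k a ++ x)).card ≤ (runsR (a :: x)).multichoose t := by
  intro x
  induction x with
  | nil =>
    intro a k t
    refine le_trans (card_delF_replicate 0 a [] ?_ t k) ?_
    · intro s
      cases s with
      | zero => simp [delF_zero]
      | succ s => simp [delF]
    · simp [runsR]
  | cons b x ih =>
    intro a k t
    by_cases hab : a = b
    · subst hab
      have := ih a (k+1) t
      rw [List.replicate_succ'] at this
      simpa [runsR] using this
    · have h := card_delF_replicate (runsR (b :: x)) a (b :: x)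
        (fun s => by simpa using ih b 1 s) t k
      simpa [runsR, hab, add_comm] using h

theorem card_delF_le (t : ℕ) (x : List Bool) :
    (delF t x).card ≤ (runsR x).multichoose t := by
  cases x with
  | nil =>
    cases t with
    | zero => simp [delF_zero]
    | succ s => simp [delF]
  | cons a x => simpa using card_delF_le_aux x a 1 t

/-- All binary words of length `n`. -/
def words : ℕ → Finset (List Bool)
  | 0 => {[]}
  | n+1 => (words n).image (fun y => true :: y) ∪ (words n).image (fun y => false :: y)

theorem mem_words : ∀ (n : ℕ) (x : List Bool), x ∈ words n ↔ x.length = n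
  | 0, x => by simp [words]
  | n+1, [] => by simp [words]
  | n+1, a :: x => by cases a <;> simp [words, mem_words n x]

theorem sum_words (n : ℕ) (f : List Bool → ℝ) :
    ∑ x ∈ words (n+1), f x = ∑ x ∈ words n, (f (true :: x) + f (false :: x)) := by
  rw [words, Finset.sum_union, Finset.sum_image, Finset.sum_image, Finset.sum_add_distrib]
  · intro y _ z _ h; simpa using h
  · intro y _ z _ h; simpa using h
  · rw [Finset.disjoint_left]
    intro z hz hz'
    simp only [Finset.mem_image] at hz hz'
    obtain ⟨y, _, rfl⟩ := hz
    obtain ⟨y', _, h⟩ := hz'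
    simp at h

theorem card_words (n : ℕ) : ((words n).card : ℝ) = 2 ^ n := by
  induction n with
  | zero => simp [words]
  | succ n ih =>
    have := sum_words n (fun _ => 1)
    simp at this
    rw [this, ih]; ring

theorem mgf_words (s : ℝ) (n : ℕ) :
    ∑ x ∈ words (n+1), Real.exp (s * (2 * runsR x - (n+1))) =
      2 ^ (n+1) * Real.exp s * Real.cosh s ^ n := by
  induction n with
  | zero => simp [words, runsR]; ring_nf
  | succ n ih =>
    rw [sum_words]
    have : ∀ x ∈ words (n+1),
        Real.exp (s * (2 * runsR (true :: x) - ((n+1 : ℕ)+1)))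
         + Real.exp (s * (2 * runsR (false :: x) - ((n+1 : ℕ)+1)))
         = Real.exp (s * (2 * runsR x - (n+1))) * (2 * Real.cosh s) := by
      intro x hx
      rw [mem_words] at hx
      rw [Real.cosh_eq]
      have e : Real.exp (s * (2 * runsR x - (n+1))) * (2 * ((Real.exp s + Real.exp (-s)) / 2))
        = Real.exp (s * (2 * runsR x - (n+1)) + s) + Real.exp (s * (2 * runsR x - (n+1)) + - s) := by
        rw [Real.exp_add, Real.exp_add]; ring
      rw [e]
      match x, hx with
      | true :: x, _ =>
        simp only [runsR]; simp
        rw [add_comm]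
        congr 2 <;> ring
      | false :: x, _ =>
        simp only [runsR]; simp
        congr 2 <;> ring
    rw [Finset.sum_congr rfl this, ← Finset.sum_mul, ih]
    ring

theorem mgf_words_le (s : ℝ) (n : ℕ) (hn : 0 < n) :
    ∑ x ∈ words n, Real.exp (s * (2 * runsR x - n)) ≤
      2 ^ n * Real.exp (|s| + n * s ^ 2 / 2) := by
  obtain ⟨m, rfl⟩ : ∃ m, n = m + 1 := ⟨n - 1, by omega⟩
  have h := mgf_words s m
  push_cast
  rw [h, mul_assoc]
  apply mul_le_mul_of_nonneg_left _ (by positivity)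
  rw [Real.exp_add]
  apply mul_le_mul (Real.exp_le_exp.2 (le_abs_self s)) _ (by positivity) (by positivity)
  calc Real.cosh s ^ m ≤ Real.exp (s^2/2) ^ m := by
        gcongr
        exact Real.cosh_le_exp_half_sq s
    _ = Real.exp (m * (s^2/2)) := by rw [← Real.exp_nat_mul]
    _ ≤ _ := by
        apply Real.exp_le_exp.2
        nlinarith [sq_nonneg s]

theorem card_atypical (s d : ℝ) (hs : 0 ≤ s) (n : ℕ) (hn : 0 < n) :
    (((words n).filter (fun x => d < |2 * (runsR x : ℝ) - n|)).card : ℝ) ≤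
      2 ^ n * (2 * Real.exp (s + n * s ^ 2 / 2 - s * d)) := by
  have h1 := mgf_words_le s n hn
  have h2 := mgf_words_le (-s) n hn
  rw [abs_of_nonneg hs] at h1
  rw [abs_neg, abs_of_nonneg hs, neg_sq] at h2
  have key : ∀ x ∈ (words n).filter (fun x => d < |2 * (runsR x : ℝ) - n|),
      (1 : ℝ) ≤ Real.exp (-(s * d)) * (Real.exp (s * (2 * runsR x - n))
        + Real.exp (-s * (2 * runsR x - n))) := by
    intro x hx
    have hx := (Finset.mem_filter.1 hx).2
    rw [mul_add, ← Real.exp_add, ← Real.exp_add]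
    have p1 := Real.exp_pos (-(s * d) + s * (2 * runsR x - n))
    have p2 := Real.exp_pos (-(s * d) + -s * (2 * runsR x - n))
    rcases lt_abs.1 hx with h | h
    · have : 1 ≤ Real.exp (-(s * d) + s * (2 * runsR x - n)) := by
        apply Real.one_le_exp; nlinarith
      linarith
    · have : 1 ≤ Real.exp (-(s * d) + -s * (2 * runsR x - n)) := by
        apply Real.one_le_exp; nlinarith
      linarith
  calc _ = ∑ x ∈ (words n).filter (fun x => d < |2 * (runsR x : ℝ) - n|), (1 : ℝ) := by simp
    _ ≤ _ := Finset.sum_le_sum key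
    _ ≤ ∑ x ∈ words n, Real.exp (-(s * d)) * (Real.exp (s * (2 * runsR x - n))
        + Real.exp (-s * (2 * runsR x - n))) :=
        Finset.sum_le_sum_of_subset_of_nonneg (Finset.filter_subset _ _)
          (fun _ _ _ => by positivity)
    _ = Real.exp (-(s * d)) * (∑ x ∈ words n, Real.exp (s * (2 * runsR x - n))
        + ∑ x ∈ words n, Real.exp (-s * (2 * runsR x - n))) := by
        rw [← Finset.mul_sum, Finset.sum_add_distrib]
    _ ≤ Real.exp (-(s * d)) * (2 ^ n * Real.exp (s + n * s ^ 2 / 2)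
         + 2 ^ n * Real.exp (s + n * s ^ 2 / 2)) := by gcongr
    _ = _ := by
        rw [sub_eq_add_neg, Real.exp_add _ (-(s * d))]; ring

/-- lower bound on sphere sizes, real form -/
theorem delF_lower (t : ℕ) (x : List Bool) (l : ℝ) (hl : 0 ≤ l) (h : l + 2 * t ≤ runsR x) :
    l ^ t ≤ t.factorial * ((delF t x).card : ℝ) := by
  have hr : 2 * t ≤ runsR x := by
    have : (2 * t : ℝ) ≤ runsR x := by linarith
    exact_mod_cast this
  obtain ⟨m, hm⟩ : ∃ m, runsR x = m + 2 * t := ⟨runsR x - 2 * t, by omega⟩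
  have h1 := choose_le_card_delF x (m + t) t (by omega)
  have h2 := Nat.pow_sub_le_descFactorial (m + t) t
  rw [Nat.descFactorial_eq_factorial_mul_choose] at h2
  have h3 : m ^ t ≤ (m + t + 1 - t) ^ t := Nat.pow_le_pow_left (by omega) t
  have h4 : m ^ t ≤ t.factorial * (delF t x).card :=
    le_trans h3 (le_trans h2 (Nat.mul_le_mul_left _ h1))
  have h5 : l ≤ m := by
    rw [hm] at h; push_cast at h; linarith
  calc l ^ t ≤ (m : ℝ) ^ t := by gcongr
    _ ≤ _ := by exact_mod_cast h4

/-- upper bound on sphere sizes, real form -/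
theorem delF_upper (t : ℕ) (x : List Bool) (u : ℝ) (h : runsR x + t ≤ u) :
    t.factorial * ((delF t x).card : ℝ) ≤ u ^ t := by
  have h1 := card_delF_le t x
  rw [Nat.multichoose_eq] at h1
  have h2 : t.factorial * (delF t x).card ≤ (runsR x + t) ^ t := by
    calc _ ≤ t.factorial * (runsR x + t - 1).choose t := Nat.mul_le_mul_left _ h1
      _ = (runsR x + t - 1).descFactorial t := by rw [Nat.descFactorial_eq_factorial_mul_choose]
      _ ≤ (runsR x + t - 1) ^ t := Nat.descFactorial_le_pow _ _
      _ ≤ _ := Nat.pow_le_pow_left (by omega) t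
  calc _ ≤ ((runsR x : ℝ) + t) ^ t := by exact_mod_cast h2
    _ ≤ _ := by gcongr

theorem perfect_sum (t n : ℕ) (htn : t ≤ n) (C : Set (List Bool))
    (hC : IsPerfectDeletionCode t n C) :
    ∃ F : Finset (List Bool), F ⊆ words n ∧ C.ncard = F.card ∧
      ∑ c ∈ F, ((delF t c).card : ℝ) = 2 ^ (n - t) := by
  classical
  obtain ⟨⟨hl, hd⟩, hp⟩ := hC
  have hds : ∀ c ∈ C, ∀ y, y ∈ delF t c ↔ y ∈ delSphere t c := by
    intro c hc y
    have := hl c hc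
    simp only [mem_delF, delSphere, Set.mem_ofPred_eq]
    constructor
    · rintro ⟨h1, h2⟩; exact ⟨h1, by omega⟩
    · rintro ⟨h1, h2⟩; exact ⟨h1, by omega⟩
  have hF : ∀ c, c ∈ (words n).filter (· ∈ C) ↔ c ∈ C := by
    intro c
    simp only [Finset.mem_filter, mem_words]
    exact ⟨fun h => h.2, fun h => ⟨hl c h, h⟩⟩
  refine ⟨(words n).filter (· ∈ C), Finset.filter_subset _ _, ?_, ?_⟩
  · rw [← Set.ncard_coe_finset]
    congr 1
    ext c
    rw [Finset.mem_coe, hF]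
  · rw [← card_words, ← Nat.cast_sum, ← Finset.card_biUnion]
    · congr 2
      ext y
      have h := Set.ext_iff.1 hp y
      simp only [delSphereSet, Set.mem_iUnion, Set.mem_ofPred_eq, exists_prop] at h
      rw [mem_words, ← h, Finset.mem_biUnion]
      constructor
      · rintro ⟨c, hc, hy⟩
        rw [hF] at hc
        exact ⟨c, hc, (hds c hc y).1 hy⟩
      · rintro ⟨c, hc, hy⟩
        exact ⟨c, (hF c).2 hc, (hds c hc y).2 hy⟩
    · intro c hc d hd' hne
      rw [Finset.mem_coe, hF] at hc hd'
      change Disjoint (delF t c) (delF t d)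
      rw [Finset.disjoint_left]
      intro y h1 h2
      have : y ∈ delSphere t c ∩ delSphere t d := ⟨(hds c hc y).1 h1, (hds d hd' y).1 h2⟩
      rw [hd c hc d hd' hne] at this
      exact this

set_option maxHeartbeats 1000000 in
theorem perfect_bounds (t n : ℕ) (htn : t ≤ n) (hn : 0 < n) (C : Set (List Bool))
    (hC : IsPerfectDeletionCode t n C) (d e : ℝ) (hd : 0 ≤ d) (hd4 : 0 < n - d - 4 * t)
    (he : (((words n).filter (fun x => d < |2 * (runsR x : ℝ) - n|)).card : ℝ) ≤ 2 ^ n * e) :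
    (C.ncard : ℝ) * (n : ℝ) ^ t / ((t.factorial : ℝ) * 2 ^ n) ≤
        n ^ t * e + (n / (n - d - 4 * t)) ^ t ∧
    (1 - 4 ^ t * (n ^ t * e)) * (n / (n + d + 2 * t)) ^ t ≤
      (C.ncard : ℝ) * (n : ℝ) ^ t / ((t.factorial : ℝ) * 2 ^ n) := by
  classical
  obtain ⟨F, hF, hcard, hsum⟩ := perfect_sum t n htn C hC
  rw [hcard]
  set A := F.filter (fun x => d < |2 * (runsR x : ℝ) - n|) with hA
  set T := F.filter (fun x => ¬ d < |2 * (runsR x : ℝ) - n|) with hT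
  have hcAT : (A.card : ℝ) + T.card = F.card := by
    exact_mod_cast Finset.card_filter_add_card_filter_not (s := F) _
  have hAe : (A.card : ℝ) ≤ 2 ^ n * e := by
    refine le_trans ?_ he
    exact Nat.cast_le.2 (Finset.card_le_card (Finset.filter_subset_filter _ hF))
  have hsAT : ∑ c ∈ A, ((delF t c).card : ℝ) + ∑ c ∈ T, ((delF t c).card : ℝ) = 2 ^ (n - t) := by
    rw [← hsum]; exact Finset.sum_filter_add_sum_filter_not _ _ _
  have hpow : (2 : ℝ) ^ (n - t) * 2 ^ t = 2 ^ n := by rw [← pow_add]; congr 1; omega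
  have hfac : (1 : ℝ) ≤ t.factorial := by exact_mod_cast Nat.succ_le_of_lt (Nat.factorial_pos t)
  have hn' : (0 : ℝ) < n := by exact_mod_cast hn
  have htn' : (t : ℝ) ≤ n := by exact_mod_cast htn
  have hTd : ∀ c ∈ T, |2 * (runsR c : ℝ) - n| ≤ d := by
    intro c hc
    exact not_lt.1 (Finset.mem_filter.1 hc).2
  have hAF : A ⊆ F := Finset.filter_subset _ _
  clear_value A T
  clear hA hT
  have he0 : 0 ≤ e := by
    by_contra hcon
    have : (2 : ℝ) ^ n * e < 0 := mul_neg_of_pos_of_neg (by positivity) (by linarith)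
    have : (0 : ℝ) ≤ A.card := by positivity
    linarith
  constructor
  · have h1 : (T.card : ℝ) * ((n - d - 4 * t) / 2) ^ t ≤ t.factorial * 2 ^ (n - t) := by
      calc (T.card : ℝ) * ((n - d - 4 * t) / 2) ^ t = ∑ c ∈ T, ((n - d - 4 * t) / 2) ^ t := by
            simp
        _ ≤ ∑ c ∈ T, (t.factorial * ((delF t c).card : ℝ)) := by
            apply Finset.sum_le_sum
            intro c hc
            apply delF_lower _ _ _ (by linarith)
            have := (abs_le.1 (hTd c hc)).1
            linarith
        _ = t.factorial * ∑ c ∈ T, ((delF t c).card : ℝ) := by rw [Finset.mul_sum]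
        _ ≤ _ := by
            apply mul_le_mul_of_nonneg_left _ (by positivity)
            rw [← hsAT]
            have : 0 ≤ ∑ c ∈ A, ((delF t c).card : ℝ) :=
              Finset.sum_nonneg (fun _ _ => Nat.cast_nonneg _)
            linarith
    have h2 : (T.card : ℝ) * (n - d - 4 * t) ^ t ≤ t.factorial * 2 ^ n := by
      rw [div_pow, ← mul_div_assoc, div_le_iff₀ (by positivity), mul_assoc, hpow] at h1
      exact h1
    have h3 : (T.card : ℝ) * n ^ t / (t.factorial * 2 ^ n) ≤ (n / (n - d - 4 * t)) ^ t := by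
      rw [div_pow, div_le_div_iff₀ (by positivity) (by positivity)]
      calc (T.card : ℝ) * n ^ t * (n - d - 4 * t) ^ t
          = n ^ t * (T.card * (n - d - 4 * t) ^ t) := by ac_rfl
        _ ≤ _ := mul_le_mul_of_nonneg_left h2 (by positivity)
    have h4 : (A.card : ℝ) * n ^ t / (t.factorial * 2 ^ n) ≤ n ^ t * e := by
      rw [div_le_iff₀ (by positivity)]
      calc (A.card : ℝ) * n ^ t ≤ 2 ^ n * e * n ^ t := by gcongr
        _ = n ^ t * e * (1 * 2 ^ n) := by ring
        _ ≤ _ := by gcongr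
    rw [← hcAT, add_mul, add_div]
    linarith
  · have h1 : t.factorial * (2 : ℝ) ^ (n - t) ≤
        2 ^ n * e * (2 * n) ^ t + F.card * ((n + d + 2 * t) / 2) ^ t := by
      rw [← hsAT, mul_add, Finset.mul_sum, Finset.mul_sum]
      apply add_le_add
      · calc ∑ c ∈ A, (t.factorial * ((delF t c).card : ℝ)) ≤ ∑ c ∈ A, (2 * (n : ℝ)) ^ t := by
              apply Finset.sum_le_sum
              intro c hc
              apply delF_upper
              have h5 := runsR_le_length c
              rw [(mem_words n c).1 (hF (hAF hc))] at h5
              have h6 : (runsR c : ℝ) ≤ n := by exact_mod_cast h5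
              linarith
          _ = A.card * (2 * (n : ℝ)) ^ t := by simp
          _ ≤ _ := by gcongr
      · calc ∑ c ∈ T, (t.factorial * ((delF t c).card : ℝ)) ≤
              ∑ c ∈ T, ((n + d + 2 * t) / 2) ^ t := by
              apply Finset.sum_le_sum
              intro c hc
              apply delF_upper
              have := (abs_le.1 (hTd c hc)).2
              linarith
          _ = T.card * ((n + d + 2 * t) / 2) ^ t := by simp
          _ ≤ _ := by
              have : (0 : ℝ) ≤ A.card := by positivity
              exact mul_le_mul_of_nonneg_right (by linarith) (by positivity)
    have h2 : t.factorial * (2 : ℝ) ^ n ≤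
        2 ^ n * (4 ^ t * (n ^ t * e)) + F.card * (n + d + 2 * t) ^ t := by
      have h3 := mul_le_mul_of_nonneg_right h1 (show (0:ℝ) ≤ 2 ^ t by positivity)
      rw [mul_assoc, hpow, add_mul, div_pow, mul_assoc (F.card : ℝ),
        div_mul_cancel₀ _ (by positivity)] at h3
      refine le_trans h3 (le_of_eq ?_)
      rw [mul_pow, show (4 : ℝ) = 2 * 2 by norm_num, mul_pow]
      ring
    have h3 : t.factorial * 2 ^ n * (1 - 4 ^ t * (n ^ t * e)) ≤ F.card * (n + d + 2 * t) ^ t := by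
      have : 2 ^ n * (4 ^ t * (n ^ t * e)) ≤ t.factorial * (2 ^ n * (4 ^ t * (n ^ t * e))) :=
        le_mul_of_one_le_left (by positivity) hfac
      have e5 : t.factorial * 2 ^ n * (1 - 4 ^ t * ((n : ℝ) ^ t * e)) =
        t.factorial * 2 ^ n - t.factorial * (2 ^ n * (4 ^ t * (n ^ t * e))) := by
        rw [mul_sub, mul_one, mul_assoc]
      rw [e5]
      linarith
    rw [div_pow, ← mul_div_assoc, div_le_div_iff₀ (by positivity) (by positivity)]
    calc (1 - 4 ^ t * ((n : ℝ) ^ t * e)) * n ^ t * (t.factorial * 2 ^ n)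
        = n ^ t * (t.factorial * 2 ^ n * (1 - 4 ^ t * (n ^ t * e))) := by ac_rfl
      _ ≤ n ^ t * (F.card * (n + d + 2 * t) ^ t) :=
        mul_le_mul_of_nonneg_left h3 (by positivity)
      _ = _ := by ac_rfl

/-- If perfect `t`-deletion codes exist for an infinite strictly increasing sequence of
lengths `a i`, then their sizes are asymptotically `t!·2^{a i}/(a i)^t`. -/
theorem perfect_codes_on_subsequence_asymptotics (t : ℕ) (ht : 0 < t)
    (a : ℕ → ℕ) (ha : StrictMono a) (hapos : ∀ i, 0 < a i)
    (C : ℕ → Set (List Bool)) (hC : ∀ i, IsPerfectDeletionCode t (a i) (C i)) :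
    Tendsto (fun i : ℕ =>
        ((C i).ncard : ℝ) * (a i : ℝ) ^ t / ((t.factorial : ℝ) * 2 ^ (a i)))
      atTop (nhds 1) := by
  have hx : Tendsto (fun i => (a i : ℝ) ^ (1/4 : ℝ)) atTop atTop :=
    (tendsto_rpow_atTop (by norm_num)).comp
      (tendsto_natCast_atTop_atTop.comp ha.tendsto_atTop)
  have hx4 : ∀ i, (((a i : ℝ) ^ (1/4 : ℝ)) ^ 4 : ℝ) = a i := by
    intro i
    rw [← Real.rpow_natCast, ← Real.rpow_mul (by positivity)]
    norm_num
  generalize hX : (fun i => (a i : ℝ) ^ (1/4 : ℝ)) = X at hx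
  have hX4 : ∀ i, X i ^ 4 = a i := fun i => by rw [← hX]; exact hx4 i
  -- the exponential error
  let E : ℝ → ℝ := fun x => 2 * Real.exp (2 - x)
  have hE : Tendsto (fun x : ℝ => (x ^ 4) ^ t * E x) atTop (nhds 0) := by
    have h := (Real.tendsto_pow_mul_exp_neg_atTop_nhds_zero (4 * t)).const_mul (2 * Real.exp 2)
    rw [mul_zero] at h
    refine h.congr fun x => ?_
    simp only [E]
    rw [sub_eq_add_neg, Real.exp_add, pow_mul]
    ring
  have hinv : Tendsto (fun x : ℝ => x⁻¹) atTop (nhds 0) := tendsto_inv_atTop_zero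
  have hq : ∀ b c : ℝ, Tendsto (fun x : ℝ => (x ^ 4 / (x ^ 4 + b * x ^ 3 + c * t)) ^ t)
      atTop (nhds 1) := by
    intro b c
    have h1 : Tendsto (fun x : ℝ => ((1 + b * x⁻¹ + c * t * (x⁻¹) ^ 4)⁻¹) ^ t) atTop
        (nhds (((1 + b * 0 + c * t * 0 ^ 4)⁻¹) ^ t)) := by
      apply Tendsto.pow
      apply Tendsto.inv₀
      · exact (tendsto_const_nhds.add (hinv.const_mul b)).add ((hinv.pow 4).const_mul _)
      · simp
    have e1 : ((1 + b * 0 + c * t * 0 ^ 4)⁻¹ : ℝ) ^ t = 1 := by simp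
    rw [e1] at h1
    refine h1.congr' ?_
    filter_upwards [eventually_gt_atTop 0] with x hx0
    congr 1
    have : x ^ 4 + b * x ^ 3 + c * t = x ^ 4 * (1 + b * x⁻¹ + c * t * (x⁻¹) ^ 4) := by
      field_simp
    rw [this, ← div_div, div_self (by positivity), one_div]
  have hup : Tendsto (fun i => (X i ^ 4) ^ t * E (X i) +
      (X i ^ 4 / (X i ^ 4 + (-1) * X i ^ 3 + (-4) * t)) ^ t) atTop (nhds 1) := by
    simpa [Function.comp_def] using ((hE.add (hq (-1) (-4))).comp hx)
  have hlo : Tendsto (fun i => (1 - 4 ^ t * ((X i ^ 4) ^ t * E (X i))) *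
      (X i ^ 4 / (X i ^ 4 + 1 * X i ^ 3 + 2 * t)) ^ t) atTop (nhds 1) := by
    have := (((hE.const_mul (4 ^ t)).const_sub 1).mul (hq 1 2)).comp hx
    simpa [Function.comp_def] using this
  have hmain : ∀ᶠ i in atTop,
      ((C i).ncard : ℝ) * (a i : ℝ) ^ t / ((t.factorial : ℝ) * 2 ^ (a i)) ≤
        (X i ^ 4) ^ t * E (X i) + (X i ^ 4 / (X i ^ 4 + (-1) * X i ^ 3 + (-4) * t)) ^ t ∧
      (1 - 4 ^ t * ((X i ^ 4) ^ t * E (X i))) *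
      (X i ^ 4 / (X i ^ 4 + 1 * X i ^ 3 + 2 * t)) ^ t ≤
      ((C i).ncard : ℝ) * (a i : ℝ) ^ t / ((t.factorial : ℝ) * 2 ^ (a i)) := by
    filter_upwards [hx.eventually_ge_atTop (4 * t + 2)] with i hi
    have ht0 : (0 : ℝ) ≤ t := by positivity
    have hX1 : 1 ≤ X i := by linarith
    have hX0 : 0 < X i := by linarith
    have h3 : 1 ≤ X i ^ 3 := one_le_pow₀ hX1
    have hpos : 0 < X i ^ 4 - X i ^ 3 - 4 * t := by
      have : X i ^ 4 = X i ^ 3 * X i := by ring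
      nlinarith [mul_le_mul_of_nonneg_right h3 (show 0 ≤ X i - 1 by linarith)]
    have htn : t ≤ a i := by
      have : (t : ℝ) ≤ a i := by rw [← hX4]; nlinarith
      exact_mod_cast this
    have hat := card_atypical ((X i ^ 2)⁻¹) (X i ^ 3) (by positivity) (a i) (hapos i)
    have hat2 : (((words (a i)).filter
        (fun x => X i ^ 3 < |2 * (runsR x : ℝ) - a i|)).card : ℝ) ≤ 2 ^ (a i) * E (X i) := by
      refine le_trans hat ?_
      simp only [E]
      refine mul_le_mul_of_nonneg_left (mul_le_mul_of_nonneg_left (Real.exp_le_exp.2 ?_)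
        (by norm_num)) (by positivity)
      rw [← hX4]
      have e1 : X i ^ 4 * ((X i ^ 2)⁻¹) ^ 2 / 2 = 1 / 2 := by field_simp
      have e2 : (X i ^ 2)⁻¹ * X i ^ 3 = X i := by field_simp
      have e3 : (X i ^ 2)⁻¹ ≤ 1 := inv_le_one_of_one_le₀ (one_le_pow₀ hX1)
      rw [e1, e2]; linarith
    have hb := perfect_bounds t (a i) htn (hapos i) (C i) (hC i) (X i ^ 3) (E (X i))
      (by positivity) (by rw [← hX4]; exact hpos) hat2
    rw [← hX4] at hb ⊢
    have e4 : X i ^ 4 + (-1) * X i ^ 3 + (-4) * t = X i ^ 4 - X i ^ 3 - 4 * t := by ring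
    rw [e4, one_mul]
    exact hb
  exact tendsto_of_tendsto_of_tendsto_of_le_of_le' hlo hup
    (hmain.mono fun i h => h.2) (hmain.mono fun i h => h.1)
end
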